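/- Let H(τ) := 2(θ₂(τ)⁴ − θ₄(τ)⁴)/η(τ)³ − (24/θ₃(τ)) ∑_{n∈ℤ} q^{n²/2 − 1/8}/(1 + q^{n−1/2}) and Ĥ(τ) := H(τ) − 12 i ∫_{−τ̄}^{i∞} η(w)³ (−i(w+τ))^{−1/2} dw. Then the completion vanishes at the elliptic points of SL(2,ℤ): Ĥ(i) = 0 and Ĥ(e^{2πi/3}) = 0. -/

import Mathlib

open Complex MeasureTheory

noncomputable section

/-- `e^{2πiτs}`, i.e. `q^s` for `q = e^{2πiτ}`. -/
def qp (τ s : ℂ) : ℂ := Complex.exp (2 * (Real.pi : ℂ) * Complex.I * τ * s)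

/-- Jacobi theta constant `θ₂(τ) = ∑_{r∈ℤ+1/2} q^{r²/2}`. -/
def theta2 (τ : ℂ) : ℂ := ∑' n : ℤ, qp τ (((n : ℂ) + 1 / 2) ^ 2 / 2)

/-- Jacobi theta constant `θ₃(τ) = ∑_{n∈ℤ} q^{n²/2}`. -/
def theta3 (τ : ℂ) : ℂ := ∑' n : ℤ, qp τ ((n : ℂ) ^ 2 / 2)

/-- Jacobi theta constant `θ₄(τ) = ∑_{n∈ℤ} (−1)ⁿ q^{n²/2}`. -/
def theta4 (τ : ℂ) : ℂ := ∑' n : ℤ, (-1 : ℂ) ^ n * qp τ ((n : ℂ) ^ 2 / 2)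

/-- Dedekind eta function `η(τ) = q^{1/24} ∏_{n≥1}(1 − qⁿ)`. -/
def etaDedekind (τ : ℂ) : ℂ :=
  Complex.exp ((Real.pi : ℂ) * Complex.I * τ / 12) * ∏' n : ℕ, (1 - qp τ ((n : ℂ) + 1))

/-- The Mathieu moonshine q-series
`H(τ) = 2(θ₂⁴ − θ₄⁴)/η³ − (24/θ₃) ∑_{n∈ℤ} q^{n²/2−1/8}/(1 + q^{n−1/2})`. -/
def H0 (τ : ℂ) : ℂ :=
  2 * (theta2 τ ^ 4 - theta4 τ ^ 4) / etaDedekind τ ^ 3 -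
    (24 / theta3 τ) *
      ∑' n : ℤ, qp τ ((n : ℂ) ^ 2 / 2 - 1 / 8) / (1 + qp τ ((n : ℂ) - 1 / 2))

/-- The Eichler integral `∫_{−τ̄}^{i∞} η(w)³ (−i(w+τ))^{−1/2} dw`, taken along the
vertical path `w = −τ̄ + it`, `t ∈ (0,∞)`, with the principal branch. -/
def eichler (τ : ℂ) : ℂ :=
  ∫ t in Set.Ioi (0 : ℝ),
    (etaDedekind (-(starRingEnd ℂ) τ + Complex.I * (t : ℂ))) ^ 3 *
      (-Complex.I * ((-(starRingEnd ℂ) τ + Complex.I * (t : ℂ)) + τ)) ^ (-(1 / 2) : ℂ) *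
      Complex.I

/-- The non-holomorphic completion `Ĥ(τ) = H(τ) − 12i ∫_{−τ̄}^{i∞} η(w)³(−i(w+τ))^{−1/2} dw`. -/
def Hhat (τ : ℂ) : ℂ := H0 τ - 12 * Complex.I * eichler τ


open scoped Real Topology
open Filter


/-- infinite q-Pochhammer symbol -/
def PP (q c : ℂ) : ℂ := ∏' n : ℕ, (1 - c * q ^ n)

lemma PP_summable {q : ℂ} (hq : ‖q‖ < 1) (c : ℂ) : Summable fun n : ℕ => -(c * q ^ n) :=
  ((summable_geometric_of_norm_lt_one hq).mul_left c).neg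

lemma PP_mult {q : ℂ} (hq : ‖q‖ < 1) (c : ℂ) : Multipliable fun n : ℕ => (1 - c * q ^ n) := by
  simp_rw [sub_eq_add_neg]
  exact multipliable_one_add_of_summable (PP_summable hq c).norm

lemma PP_ne {q : ℂ} (hq : ‖q‖ < 1) {c : ℂ} (hc : ∀ n : ℕ, 1 - c * q ^ n ≠ 0) : PP q c ≠ 0 := by
  refine tprod_one_add_ne_zero_of_summable (f := fun n ↦ -(c * q ^ n)) ?_ ?_
  · intro i; simpa [sub_eq_add_neg] using hc i
  · exact (PP_summable hq c).norm

lemma PP_ne' {q : ℂ} (hq : ‖q‖ < 1) {c : ℂ} (hc : ‖c‖ < 1) : PP q c ≠ 0 := by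
  refine PP_ne hq fun n h => ?_
  have h1 : ‖c * q ^ n‖ < 1 := by
    rw [norm_mul, norm_pow]
    calc ‖c‖ * ‖q‖ ^ n ≤ ‖c‖ * 1 := by
          gcongr; exact pow_le_one₀ (norm_nonneg _) hq.le
      _ < 1 := by simpa
  rw [sub_eq_zero] at h
  rw [← h] at h1
  simp at h1

lemma PP_tendsto {q : ℂ} (hq : ‖q‖ < 1) (c : ℂ) :
    Tendsto (fun N => ∏ n ∈ Finset.range N, (1 - c * q ^ n)) atTop (𝓝 (PP q c)) :=
  (PP_mult hq c).hasProd.tendsto_prod_nat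

lemma PP_succ {q : ℂ} (hq : ‖q‖ < 1) (c : ℂ) : PP q c = (1 - c) * PP q (c * q) := by
  have h2 := (PP_tendsto hq (c * q)).const_mul (1 - c)
  refine tendsto_nhds_unique ((tendsto_add_atTop_iff_nat 1).2 (PP_tendsto hq c)) (h2.congr fun N => ?_)
  rw [Finset.prod_range_succ']
  rw [mul_comm]
  congr 1
  · refine Finset.prod_congr rfl fun n _ => ?_
    ring
  · simp

lemma PP_mul_neg {q : ℂ} (hq : ‖q‖ < 1) (c : ℂ) : PP q c * PP q (-c) = PP (q ^ 2) (c ^ 2) := by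
  rw [PP, PP, PP, ← (PP_mult hq c).tprod_mul (PP_mult hq (-c))]
  refine tprod_congr fun n => ?_
  rw [← pow_mul, mul_comm 2 n, pow_mul]; ring

lemma PP_split {q : ℂ} (hq : ‖q‖ < 1) (c : ℂ) : PP q c = PP (q ^ 2) c * PP (q ^ 2) (c * q) := by
  have hq2 : ‖q ^ 2‖ < 1 := by rw [norm_pow]; exact pow_lt_one₀ (norm_nonneg _) hq two_ne_zero
  have e1 : ∀ k : ℕ, (1 - c * q ^ (2 * k)) = (1 - c * (q ^ 2) ^ k) := fun k => by rw [pow_mul]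
  have e2 : ∀ k : ℕ, (1 - c * q ^ (2 * k + 1)) = (1 - c * q * (q ^ 2) ^ k) := fun k => by
    rw [pow_succ, pow_mul]; ring
  have := tprod_even_mul_odd (f := fun n : ℕ => (1 - c * q ^ n))
    (by simp only [e1]; exact PP_mult hq2 c) (by simp only [e2]; exact PP_mult hq2 _)
  simp only [e1, e2] at this
  exact this.symm

lemma PP_continuous {q : ℂ} (hq : ‖q‖ < 1) : Continuous (PP q) := by
  rw [continuous_iff_continuousAt]
  intro c
  have hs : Summable fun n : ℕ => (‖c‖ + 1) * ‖q‖ ^ n :=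
    (summable_geometric_of_lt_one (norm_nonneg _) hq).mul_left _
  have := hs.hasProdLocallyUniformlyOn_nat_one_add (f := fun n (x : ℂ) => -(x * q ^ n))
    (K := Metric.ball c 1) Metric.isOpen_ball
    (.of_forall fun n x hx ↦ ?_) (fun _ ↦ by fun_prop)
  · have h2 := this.tendstoLocallyUniformlyOn_finsetRange.continuousOn
      (Eventually.frequently (.of_forall fun N => by fun_prop))
    have h3 : ContinuousOn (PP q) (Metric.ball c 1) := by
      refine h2.congr fun x hx => ?_
      simp [PP, sub_eq_add_neg]
    exact h3.continuousAt (Metric.ball_mem_nhds _ one_pos)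
  · rw [norm_neg, norm_mul, norm_pow]
    gcongr
    rw [Metric.mem_ball, dist_eq_norm] at hx
    have := norm_add_le (x - c) c
    rw [sub_add_cancel] at this
    linarith

/-- finite q-factorial -/
def qf (q : ℂ) (n : ℕ) : ℂ := ∏ k ∈ Finset.range n, (1 - q ^ (k + 1))

lemma qf_succ (q : ℂ) (n : ℕ) : qf q (n + 1) = qf q n * (1 - q ^ (n + 1)) := Finset.prod_range_succ _ _

lemma one_sub_pow_ne {q : ℂ} (hq : ‖q‖ < 1) (n : ℕ) : 1 - q ^ (n + 1) ≠ 0 := by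
  intro h
  have : ‖q ^ (n + 1)‖ < 1 := by rw [norm_pow]; exact pow_lt_one₀ (norm_nonneg _) hq (by omega)
  rw [sub_eq_zero] at h
  rw [← h] at this
  simp at this

lemma qf_ne {q : ℂ} (hq : ‖q‖ < 1) (n : ℕ) : qf q n ≠ 0 :=
  Finset.prod_ne_zero_iff.2 fun k _ => one_sub_pow_ne hq k

lemma qf_tendsto {q : ℂ} (hq : ‖q‖ < 1) : Tendsto (qf q) atTop (𝓝 (PP q q)) := by
  refine (PP_tendsto hq q).congr fun N => Finset.prod_congr rfl fun n _ => by ring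



lemma tri_succ (k : ℕ) : (k + 1) * (k + 1 - 1) / 2 = k * (k - 1) / 2 + k := by
  have := Finset.sum_range_id_mul_two k
  have h2 := Finset.sum_range_id_mul_two (k+1)
  rw [Finset.sum_range_succ] at h2
  simp only [Nat.add_sub_cancel] at *
  omega

lemma qbinom {q : ℂ} (hq : ‖q‖ < 1) (z : ℂ) (N : ℕ) :
    ∏ k ∈ Finset.range N, (1 + z * q ^ k) =
      ∑ j ∈ Finset.range (N + 1), qf q N / (qf q j * qf q (N - j)) * q ^ (j * (j - 1) / 2) * z ^ j := by
  induction N with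
  | zero => simp [qf]
  | succ N ih =>
    rw [Finset.prod_range_succ, ih, mul_add, mul_one]
    nth_rewrite 1 [Finset.sum_range_succ']
    nth_rewrite 1 [Finset.sum_range_succ]
    rw [Finset.sum_range_succ' _ (N+1), Finset.sum_range_succ _ N]
    have e1 : ∀ k ∈ Finset.range N, qf q (N+1) / (qf q (k+1) * qf q (N + 1 - (k+1))) * q ^ ((k+1) * (k+1 - 1) / 2) * z ^ (k+1)
      = qf q N / (qf q (k+1) * qf q (N - (k+1))) * q ^ ((k+1) * (k+1 - 1) / 2) * z ^ (k+1)
        + qf q N / (qf q k * qf q (N - k)) * q ^ (k * (k - 1) / 2) * z ^ k * (z * q ^ N) := by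
      intro k hk
      obtain ⟨d, rfl⟩ := Nat.exists_eq_add_of_lt (Finset.mem_range.mp hk)
      have a1 : k + d + 1 + 1 - (k + 1) = d + 1 := by omega
      have a2 : k + d + 1 - (k + 1) = d := by omega
      have a3 : k + d + 1 - k = d + 1 := by omega
      rw [a1, a2, a3, tri_succ, qf_succ q (k+d+1), qf_succ q d, qf_succ q k]
      have h1 := qf_ne hq d
      have h2 := qf_ne hq k
      have h3 := one_sub_pow_ne hq d
      have h4 := one_sub_pow_ne hq k
      field_simp
      ring
    rw [Finset.sum_congr rfl e1, Finset.sum_add_distrib, add_mul, Finset.sum_mul]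
    have h0 : qf q 0 = 1 := by simp [qf]
    have h2 := qf_ne hq N
    have h5 := qf_ne hq (N+1)
    simp only [Nat.sub_self, Nat.sub_zero, tri_succ, h0]
    field_simp
    ring_nf
    congr 1
    exact Finset.sum_congr rfl fun _ _ => by ring

lemma prod_neg_part {p y : ℂ} (hp : p ≠ 0) (hy : y ≠ 0) (n : ℕ) :
    ∏ i ∈ Finset.range n, (1 + y * p ^ (-(2 * (i : ℤ) + 1))) =
      y ^ n * p ^ (-(n : ℤ) ^ 2) * ∏ i ∈ Finset.range n, (1 + y⁻¹ * p ^ (2 * i + 1)) := by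
  induction n with
  | zero => simp
  | succ n ih =>
    rw [Finset.prod_range_succ, Finset.prod_range_succ, ih]
    have h1 : p ^ (-(((n + 1 : ℕ) : ℤ)) ^ 2) = p ^ (-(n : ℤ) ^ 2) * p ^ (-(2 * (n : ℤ) + 1)) := by
      rw [← zpow_add₀ hp]; congr 1; push_cast; ring
    have h2 : p ^ (-(2 * (n : ℤ) + 1)) * p ^ (2 * n + 1) = 1 := by
      rw [← zpow_natCast, ← zpow_add₀ hp]; simp
    have h3 : (1 + y * p ^ (-(2 * (n : ℤ) + 1))) = y * p ^ (-(2 * (n : ℤ) + 1)) * (1 + y⁻¹ * p ^ (2 * n + 1)) := by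
      have : y * p ^ (-(2 * (n : ℤ) + 1)) * (1 + y⁻¹ * p ^ (2 * n + 1)) = y * p ^ (-(2 * (n : ℤ) + 1)) + (y * y⁻¹) * (p ^ (-(2 * (n : ℤ) + 1)) * p ^ (2 * n + 1)) := by ring
      rw [this, h2, mul_inv_cancel₀ hy]; ring
    rw [h1, h3]; ring

lemma TPfin {p y : ℂ} (hp0 : p ≠ 0) (hp : ‖p‖ < 1) (hy : y ≠ 0) (n : ℕ) :
    (∏ i ∈ Finset.range n, (1 + y * p ^ (2 * i + 1))) * ∏ i ∈ Finset.range n, (1 + y⁻¹ * p ^ (2 * i + 1)) =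
     ∑ j ∈ Finset.range (2 * n + 1), qf (p ^ 2) (2 * n) / (qf (p ^ 2) j * qf (p ^ 2) (2 * n - j))
       * p ^ (((j : ℤ) - n) ^ 2) * y ^ ((j : ℤ) - n) := by
  have hq : ‖p ^ 2‖ < 1 := by rw [norm_pow]; exact pow_lt_one₀ (norm_nonneg _) hp (by norm_num)
  have h := qbinom hq (y * p ^ (1 - 2 * (n : ℤ))) (2 * n)
  have h1 : ∏ k ∈ Finset.range (2 * n), (1 + y * p ^ (1 - 2 * (n : ℤ)) * (p ^ 2) ^ k) =
     y ^ n * p ^ (-(n : ℤ) ^ 2) * ((∏ i ∈ Finset.range n, (1 + y * p ^ (2 * i + 1))) * ∏ i ∈ Finset.range n, (1 + y⁻¹ * p ^ (2 * i + 1))) := by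
    rw [two_mul n, Finset.prod_range_add, ← Finset.prod_range_reflect]
    have a : ∏ j ∈ Finset.range n, (1 + y * p ^ (1 - 2 * (n : ℤ)) * (p ^ 2) ^ (n - 1 - j)) = ∏ i ∈ Finset.range n, (1 + y * p ^ (-(2 * (i : ℤ) + 1))) := by
      refine Finset.prod_congr rfl fun j hj => ?_
      have := Finset.mem_range.mp hj
      rw [mul_assoc, ← pow_mul, ← zpow_natCast p, ← zpow_add₀ hp0]
      congr 3
      push_cast
      omega
    have b : ∏ j ∈ Finset.range n, (1 + y * p ^ (1 - 2 * (n : ℤ)) * (p ^ 2) ^ (n + j)) = ∏ i ∈ Finset.range n, (1 + y * p ^ (2 * i + 1)) := by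
      refine Finset.prod_congr rfl fun j hj => ?_
      rw [mul_assoc, ← pow_mul, ← zpow_natCast p, ← zpow_natCast p, ← zpow_add₀ hp0]
      congr 3
      push_cast
      omega
    rw [a, b, prod_neg_part hp0 hy]
    ring
  rw [h1] at h
  have hne : y ^ n * p ^ (-(n : ℤ) ^ 2) ≠ 0 := mul_ne_zero (pow_ne_zero _ hy) (zpow_ne_zero _ hp0)
  apply mul_left_cancel₀ hne
  rw [h, Finset.mul_sum]
  refine Finset.sum_congr rfl fun j hj => ?_
  have e1 : y ^ ((j : ℤ) - n) = y ^ j * (y ^ n)⁻¹ := by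
    rw [zpow_sub₀ hy]; simp [div_eq_mul_inv]
  have e2 : p ^ (((j : ℤ) - n) ^ 2) * p ^ (-(n : ℤ) ^ 2) = (p ^ 2) ^ (j * (j - 1) / 2) * (p ^ (1 - 2 * (n : ℤ))) ^ j := by
    rw [← pow_mul, ← zpow_natCast p, ← zpow_natCast (p ^ (1 - 2 * (n : ℤ))), ← zpow_mul, ← zpow_add₀ hp0, ← zpow_add₀ hp0]
    congr 1
    have : ((2 * (j * (j - 1) / 2) : ℕ) : ℤ) = j * j - j := by
      have h5 := Finset.sum_range_id_mul_two j
      have : 2 * (j * (j - 1) / 2) = j * (j - 1) := by omega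
      rw [this]
      cases j with
      | zero => simp
      | succ k => push_cast [Nat.add_sub_cancel]; ring
    rw [this]; ring
  rw [e1, mul_pow]
  have hyn : y ^ n ≠ 0 := pow_ne_zero _ hy
  calc _ = qf (p ^ 2) (2 * n) / (qf (p ^ 2) j * qf (p ^ 2) (2 * n - j)) * y ^ j * ((p ^ 2) ^ (j * (j - 1) / 2) * (p ^ (1 - 2 * (n : ℤ))) ^ j) := by ring
    _ = qf (p ^ 2) (2 * n) / (qf (p ^ 2) j * qf (p ^ 2) (2 * n - j)) * y ^ j * (p ^ (((j : ℤ) - n) ^ 2) * p ^ (-(n : ℤ) ^ 2)) * (y ^ n * (y ^ n)⁻¹) := by rw [e2, mul_inv_cancel₀ hyn, mul_one]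
    _ = _ := by ring



lemma qf_bdd {q : ℂ} (hq : ‖q‖ < 1) : ∃ C : ℝ, 0 < C ∧ (∀ n, ‖qf q n‖ ≤ C) ∧ ∀ n, ‖(qf q n)⁻¹‖ ≤ C := by
  have hE : PP q q ≠ 0 := PP_ne' hq hq
  obtain ⟨a, ha⟩ := (qf_tendsto hq).norm.bddAbove_range
  obtain ⟨b, hb⟩ := ((qf_tendsto hq).inv₀ hE).norm.bddAbove_range
  refine ⟨max 1 (max a b), by positivity, fun n => ?_, fun n => ?_⟩
  · exact (ha ⟨n, rfl⟩).trans (by simp)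
  · exact (hb ⟨n, rfl⟩).trans (by simp)

lemma TPsum {p y : ℂ} (hp0 : p ≠ 0) (hp : ‖p‖ < 1) (hy : y ≠ 0)
    (hs : Summable fun l : ℤ => ‖p ^ (l ^ 2) * y ^ l‖) :
    ∑' l : ℤ, p ^ (l ^ 2) * y ^ l = PP (p ^ 2) (p ^ 2) * PP (p ^ 2) (-(y * p)) * PP (p ^ 2) (-(y⁻¹ * p)) := by
  have hq : ‖p ^ 2‖ < 1 := by rw [norm_pow]; exact pow_lt_one₀ (norm_nonneg _) hp (by norm_num)
  set q := p ^ 2 with hqdef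
  have hE : PP q q ≠ 0 := PP_ne' hq hq
  set f : ℕ → ℤ → ℂ := fun n l => if l.natAbs ≤ n then
    qf q (2 * n) / (qf q (n + l).toNat * qf q (n - l).toNat) * p ^ (l ^ 2) * y ^ l else 0 with hf
  have key : ∀ n, ∑' l, f n l = (∏ i ∈ Finset.range n, (1 + y * p ^ (2 * i + 1))) * ∏ i ∈ Finset.range n, (1 + y⁻¹ * p ^ (2 * i + 1)) := by
    intro n
    rw [TPfin hp0 hp hy, tsum_eq_sum (s := Finset.Icc (-(n : ℤ)) n)]
    · refine Finset.sum_nbij' (fun l => (l + n).toNat) (fun j => (j : ℤ) - n) ?_ ?_ ?_ ?_ ?_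
      · intro l hl; simp only [Finset.mem_Icc, Finset.mem_range] at *; omega
      · intro l hl; simp only [Finset.mem_Icc, Finset.mem_range] at *; omega
      · intro l hl; simp only [Finset.mem_Icc] at *; omega
      · intro l hl; simp 
      · intro l hl
        simp only [Finset.mem_Icc] at hl
        have h1 : l.natAbs ≤ n := by omega
        have h2 : ((l + n).toNat : ℤ) - n = l := by omega
        have h3 : 2 * n - (l + n).toNat = ((n : ℤ) - l).toNat := by omega
        simp only [hf, h1, if_true]
        rw [h2, h3, add_comm l]
    · intro l hl
      simp only [Finset.mem_Icc, not_and_or, not_le] at hl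
      simp only [hf]
      rw [if_neg (by omega)]
  obtain ⟨C, hC0, hC1, hC2⟩ := qf_bdd hq
  have hlim : Tendsto (fun n => ∑' l, f n l) atTop (𝓝 (∑' l : ℤ, (PP q q / (PP q q * PP q q)) * p ^ (l ^ 2) * y ^ l)) := by
    refine tendsto_tsum_of_dominated_convergence (bound := fun l : ℤ => C ^ 3 * ‖p ^ (l ^ 2) * y ^ l‖) (hs.mul_left _) ?_ ?_
    · intro l
      have ha : Tendsto (fun n : ℕ => 2 * n) atTop atTop := tendsto_id.const_mul_atTop' (by norm_num)
      have hb : Tendsto (fun n : ℕ => ((n : ℤ) + l).toNat) atTop atTop := by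
        refine tendsto_atTop_atTop.2 fun b => ⟨b + l.natAbs, fun a ha => by omega⟩
      have hc : Tendsto (fun n : ℕ => ((n : ℤ) - l).toNat) atTop atTop := by
        refine tendsto_atTop_atTop.2 fun b => ⟨b + l.natAbs, fun a ha => by omega⟩
      have ht := qf_tendsto hq
      have := (((ht.comp ha).div ((ht.comp hb).mul (ht.comp hc)) (mul_ne_zero hE hE)).mul_const (p ^ (l ^ 2))).mul_const (y ^ l)
      refine this.congr' ?_
      filter_upwards [eventually_ge_atTop l.natAbs] with n hn
      simp [hf, hn]
    · refine Eventually.of_forall fun n l => ?_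
      simp only [hf]
      split_ifs with h
      · rw [mul_assoc, norm_mul]
        gcongr
        rw [div_eq_mul_inv, mul_inv, norm_mul, norm_mul]
        have := hC1 (2 * n)
        have := hC2 (n + l).toNat
        have := hC2 (n - l).toNat
        calc _ ≤ C * (C * C) := by gcongr
          _ = C ^ 3 := by ring
      · simp only [norm_zero]; positivity
  have hlim2 := (PP_tendsto hq (-(y * p))).mul (PP_tendsto hq (-(y⁻¹ * p)))
  have hu := tendsto_nhds_unique hlim (hlim2.congr fun n => by
    rw [key]
    congr 1
    · exact Finset.prod_congr rfl fun i _ => by rw [hqdef]; ring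
    · exact Finset.prod_congr rfl fun i _ => by rw [hqdef]; ring)
  simp_rw [mul_assoc] at hu
  rw [tsum_mul_left] at hu
  rw [mul_assoc, ← hu]
  field_simp

/-- nome -/
def nm (τ : ℂ) : ℂ := cexp (π * I * τ)

lemma nm_ne (τ : ℂ) : nm τ ≠ 0 := exp_ne_zero _

lemma nm_lt {τ : ℂ} (h : 0 < τ.im) : ‖nm τ‖ < 1 := by
  rw [nm, norm_exp, Real.exp_lt_one_iff]
  simp
  positivity

lemma jt_term (n : ℤ) (z τ : ℂ) : jacobiTheta₂_term n z τ = nm τ ^ (n ^ 2) * cexp (2 * π * I * z) ^ n := by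
  rw [jacobiTheta₂_term, nm, ← exp_int_mul, ← exp_int_mul, ← exp_add]
  congr 1; push_cast; ring

lemma TP (z : ℂ) {τ : ℂ} (h : 0 < τ.im) :
    jacobiTheta₂ z τ = PP (nm τ ^ 2) (nm τ ^ 2) * PP (nm τ ^ 2) (-(cexp (2 * π * I * z) * nm τ)) *
      PP (nm τ ^ 2) (-((cexp (2 * π * I * z))⁻¹ * nm τ)) := by
  rw [← TPsum (nm_ne τ) (nm_lt h) (exp_ne_zero _), jacobiTheta₂]
  · exact tsum_congr fun n => jt_term n z τ
  · have := ((summable_jacobiTheta₂_term_iff z τ).2 h).norm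
    exact this.congr fun n => by rw [jt_term]



lemma hasDerivAt_mul_zero {a R : ℂ → ℂ} {a' z₀ : ℂ} (ha : HasDerivAt a a' z₀) (h0 : a z₀ = 0)
    (hR : ContinuousAt R z₀) : HasDerivAt (fun z => a z * R z) (a' * R z₀) z₀ := by
  rw [hasDerivAt_iff_tendsto_slope] at *
  refine (ha.mul (hR.tendsto.mono_left nhdsWithin_le_nhds)).congr fun z => ?_
  simp [slope, h0]
  ring

/-- q -/
def qq (τ : ℂ) : ℂ := nm τ ^ 2
/-- E -/
def EE (τ : ℂ) : ℂ := PP (qq τ) (qq τ)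

lemma qq_lt {τ : ℂ} (h : 0 < τ.im) : ‖qq τ‖ < 1 := by
  rw [qq, norm_pow]; exact pow_lt_one₀ (norm_nonneg _) (nm_lt h) (by norm_num)

lemma EE_ne {τ : ℂ} (h : 0 < τ.im) : EE τ ≠ 0 := PP_ne' (qq_lt h) (qq_lt h)

/-- zero -/
def zz (τ : ℂ) : ℂ := 1 / 2 - τ / 2

lemma exp_zz (τ : ℂ) : cexp (2 * π * I * zz τ) = -(nm τ)⁻¹ := by
  rw [zz, nm, ← Complex.exp_neg, ← neg_one_mul, ← Complex.exp_pi_mul_I, ← exp_add]; congr 1; ring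

lemma TP2 (z : ℂ) {τ : ℂ} (h : 0 < τ.im) :
    jacobiTheta₂ z τ = (1 + cexp (2 * π * I * z) * nm τ) * (EE τ *
      PP (qq τ) (-(cexp (2 * π * I * z) * nm τ * qq τ)) * PP (qq τ) (-((cexp (2 * π * I * z))⁻¹ * nm τ))) := by
  rw [TP z h, ← qq, ← EE, PP_succ (qq_lt h) (-(cexp (2 * π * I * z) * nm τ))]
  ring_nf

lemma jt_zz {τ : ℂ} (h : 0 < τ.im) : jacobiTheta₂ (zz τ) τ = 0 := by
  rw [TP2 _ h, exp_zz]; simp [nm_ne]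

lemma jt'_zz {τ : ℂ} (h : 0 < τ.im) : jacobiTheta₂' (zz τ) τ = -(2 * π * I) * EE τ ^ 3 := by
  have h1 := hasDerivAt_jacobiTheta₂_fst (zz τ) h
  have ha : HasDerivAt (fun z => 1 + cexp (2 * π * I * z) * nm τ) (-(2 * π * I)) (zz τ) := by
    have := ((((hasDerivAt_id (zz τ)).const_mul (2 * π * I)).cexp).mul_const (nm τ)).const_add 1
    refine HasDerivAt.congr_deriv this ?_
    simp only [id]
    rw [exp_zz]
    have := nm_ne τ
    field_simp
  have hc := PP_continuous (qq_lt h)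
  have h2 := hasDerivAt_mul_zero ha (by rw [exp_zz]; simp [nm_ne]) (R := fun z => EE τ *
      PP (qq τ) (-(cexp (2 * π * I * z) * nm τ * qq τ)) * PP (qq τ) (-((cexp (2 * π * I * z))⁻¹ * nm τ))) (by
        simp_rw [← Complex.exp_neg]
        exact (Continuous.mul (continuous_const.mul (hc.comp (by fun_prop))) (hc.comp (by fun_prop))).continuousAt)
  rw [h1.unique (h2.congr_of_eventuallyEq (Eventually.of_forall fun z => TP2 z h))]
  simp only [exp_zz]
  have e1 : -(-(nm τ)⁻¹ * nm τ * qq τ) = qq τ := by have := nm_ne τ; field_simp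
  have e2 : -((-(nm τ)⁻¹)⁻¹ * nm τ) = qq τ := by rw [qq, inv_neg, inv_inv]; ring
  rw [e1, e2, EE]; ring

lemma qp_nat (τ : ℂ) (n : ℕ) : qp τ ((n : ℂ) + 1) = qq τ * qq τ ^ n := by
  rw [← pow_succ', qq, nm, ← pow_mul, ← Complex.exp_nat_mul, qp]; congr 1; push_cast; ring

lemma eta_eq (τ : ℂ) : etaDedekind τ = cexp (π * I * τ / 12) * EE τ := by
  rw [etaDedekind, EE, PP]; simp_rw [qp_nat]

lemma eta3_eq (τ : ℂ) : etaDedekind τ ^ 3 = cexp (π * I * τ / 4) * EE τ ^ 3 := by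
  rw [eta_eq, mul_pow, ← Complex.exp_nat_mul]; congr 2; push_cast; ring

lemma eta_ne {τ : ℂ} (h : 0 < τ.im) : etaDedekind τ ≠ 0 := by
  rw [eta_eq]; exact mul_ne_zero (exp_ne_zero _) (EE_ne h)

lemma im_neg_one_div {τ : ℂ} (h : 0 < τ.im) : 0 < (-1 / τ).im := by
  have : τ ≠ 0 := by rintro rfl; simp at h
  rw [neg_div, one_div, neg_im, inv_im]
  have : 0 < normSq τ := normSq_pos.2 this
  rw [neg_div, neg_neg]; positivity

lemma jt'_add_one (z τ : ℂ) : jacobiTheta₂' (z + 1) τ = jacobiTheta₂' z τ := jacobiTheta₂'_add_left z τ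

lemma eta3_S {τ : ℂ} (h : 0 < τ.im) :
    etaDedekind τ ^ 3 = (-I * τ)⁻¹ * ((-I * τ) ^ (1 / 2 : ℂ))⁻¹ * etaDedekind (-1 / τ) ^ 3 := by
  have hτ : τ ≠ 0 := by rintro rfl; simp at h
  have h' := im_neg_one_div h
  have hf := jacobiTheta₂'_functional_equation (zz τ) τ
  have ez : zz (-1 / τ) = zz τ / τ + 1 := by rw [zz, zz]; field_simp; ring
  have e1 : jacobiTheta₂' (zz τ / τ) (-1 / τ) = -(2 * π * I) * EE (-1 / τ) ^ 3 := by
    rw [← jt'_zz h', ez, jt'_add_one]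
  have e2 : jacobiTheta₂ (zz τ / τ) (-1 / τ) = 0 := by
    rw [← jt_zz h', ez, jacobiTheta₂_add_left]
  rw [e1, e2, jt'_zz h, mul_zero, sub_zero] at hf
  have hpi : (2 * π * I : ℂ) ≠ 0 := two_pi_I_ne_zero
  have hf2 : EE τ ^ 3 = 1 / (-I * τ) ^ (1 / 2 : ℂ) * cexp (-π * I * zz τ ^ 2 / τ) / τ * EE (-1 / τ) ^ 3 := by
    apply mul_left_cancel₀ (neg_ne_zero.2 hpi)
    rw [hf]; ring
  rw [eta3_eq, hf2, eta3_eq]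
  have e3 : cexp (π * I * τ / 4) * cexp (-π * I * zz τ ^ 2 / τ) = I * cexp (π * I * (-1 / τ) / 4) := by
    rw [← exp_add]
    have : (π * I * τ / 4 + -π * I * zz τ ^ 2 / τ) = π / 2 * I + π * I * (-1 / τ) / 4 := by
      rw [zz]; field_simp; ring
    rw [this, exp_add, exp_pi_div_two_mul_I]
  have e4 : (-I * τ)⁻¹ = I / τ := by
    field_simp; simp
  rw [e4]
  calc _ = 1 / (-I * τ) ^ (1 / 2 : ℂ) / τ * EE (-1 / τ) ^ 3 * (cexp (π * I * τ / 4) * cexp (-π * I * zz τ ^ 2 / τ)) := by ring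
    _ = _ := by rw [e3]; ring

lemma hasSum_EE3 {τ : ℂ} (h : 0 < τ.im) :
    HasSum (fun n : ℕ => (-1 : ℂ) ^ n * (2 * n + 1) * nm τ ^ (n ^ 2 + n)) (EE τ ^ 3) := by
  have hs : HasSum (fun n : ℤ => jacobiTheta₂'_term n (zz τ) τ) (jacobiTheta₂' (zz τ) τ) :=
    ((summable_jacobiTheta₂'_term_iff (zz τ) τ).2 h).hasSum
  rw [jt'_zz h] at hs
  have hs2 : HasSum (fun n : ℤ => jacobiTheta₂'_term (n + 1) (zz τ) τ) (-(2 * π * I) * EE τ ^ 3) :=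
    (Equiv.addRight (1 : ℤ)).hasSum_iff.2 hs
  have hs3 := (HasSum.nat_add_neg_add_one hs2).mul_left (-(2 * π * I))⁻¹
  have hpi : (-(2 * π * I) : ℂ) ≠ 0 := neg_ne_zero.2 two_pi_I_ne_zero
  rw [inv_mul_cancel_left₀ hpi] at hs3
  refine hs3.congr_fun fun n => ?_
  have hp := nm_ne τ
  have key : ∀ m : ℤ, jacobiTheta₂_term m (zz τ) τ = (-1) ^ m * nm τ ^ (m ^ 2 - m) := by
    intro m
    rw [jt_term, exp_zz, zpow_sub₀ hp, neg_eq_neg_one_mul, mul_zpow, inv_zpow]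
    field_simp
  rw [jacobiTheta₂'_term, jacobiTheta₂'_term, key, key]
  have e1 : ((n : ℤ) + 1) ^ 2 - (n + 1) = ((n ^ 2 + n : ℕ) : ℤ) := by push_cast; ring
  have e2 : (-((n : ℤ) + 1) + 1) ^ 2 - (-((n : ℤ) + 1) + 1) = ((n ^ 2 + n : ℕ) : ℤ) := by push_cast; ring
  have e3 : ((-1 : ℂ)) ^ ((n : ℤ) + 1) = -(-1) ^ n := by
    rw [zpow_add₀ (by norm_num)]; simp
  have e4 : ((-1 : ℂ)) ^ (-((n : ℤ) + 1) + 1) = (-1) ^ n := by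
    rw [show (-((n : ℤ) + 1) + 1) = -n by ring, zpow_neg, zpow_natCast, ← inv_pow]; norm_num
  rw [e1, e2, e3, e4, zpow_natCast, inv_mul_eq_div, eq_div_iff hpi]
  push_cast
  ring

lemma hasSum_eta3 {τ : ℂ} (h : 0 < τ.im) :
    HasSum (fun n : ℕ => (-1 : ℂ) ^ n * (2 * n + 1) * cexp (π * I * τ * (n + 1 / 2) ^ 2)) (etaDedekind τ ^ 3) := by
  rw [eta3_eq]
  refine ((hasSum_EE3 h).mul_left (cexp (π * I * τ / 4))).congr_fun fun n => ?_
  rw [mul_left_comm, nm, ← Complex.exp_nat_mul, ← exp_add]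
  congr 2
  push_cast; ring


lemma theta3_jt (τ : ℂ) : theta3 τ = jacobiTheta₂ 0 τ := by
  rw [theta3, jacobiTheta₂]
  refine tsum_congr fun n => ?_
  rw [qp, jacobiTheta₂_term]; congr 1; ring

lemma cexp_pi_int (n : ℤ) : cexp (π * I * n) = (-1) ^ n := by
  rw [← exp_pi_mul_I, ← exp_int_mul]; congr 1; ring

lemma theta4_jt (τ : ℂ) : theta4 τ = jacobiTheta₂ (1 / 2) τ := by
  rw [theta4, jacobiTheta₂]
  refine tsum_congr fun n => ?_
  rw [qp, jacobiTheta₂_term, ← cexp_pi_int, ← exp_add]; congr 1; ring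

lemma theta2_jt (τ : ℂ) : theta2 τ = cexp (π * I * τ / 4) * jacobiTheta₂ (τ / 2) τ := by
  rw [theta2, jacobiTheta₂, ← tsum_mul_left]
  refine tsum_congr fun n => ?_
  rw [qp, jacobiTheta₂_term, ← exp_add]; congr 1; ring

lemma theta3_prod {τ : ℂ} (h : 0 < τ.im) : theta3 τ = EE τ * PP (qq τ) (-nm τ) ^ 2 := by
  rw [theta3_jt, TP _ h, EE, qq]; simp; ring

lemma theta4_prod {τ : ℂ} (h : 0 < τ.im) : theta4 τ = EE τ * PP (qq τ) (nm τ) ^ 2 := by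
  have : cexp (2 * π * I * (1 / 2)) = -1 := by rw [← exp_pi_mul_I]; congr 1; ring
  rw [theta4_jt, TP _ h, EE, qq, this]
  rw [inv_neg]; simp; ring

lemma theta2_prod {τ : ℂ} (h : 0 < τ.im) : theta2 τ = 2 * cexp (π * I * τ / 4) * EE τ * PP (qq τ) (-qq τ) ^ 2 := by
  have : cexp (2 * π * I * (τ / 2)) = nm τ := by rw [nm]; congr 1; ring
  rw [theta2_jt, TP _ h, this, ← qq, inv_mul_cancel₀ (nm_ne τ), PP_succ (qq_lt h) (-1), ← sq, ← qq, EE]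
  ring_nf

lemma theta3_ne {τ : ℂ} (h : 0 < τ.im) : theta3 τ ≠ 0 := by
  rw [theta3_prod h]
  exact mul_ne_zero (EE_ne h) (pow_ne_zero _ (PP_ne' (qq_lt h) (by rw [norm_neg]; exact nm_lt h)))

lemma theta4_ne {τ : ℂ} (h : 0 < τ.im) : theta4 τ ≠ 0 := by
  rw [theta4_prod h]
  exact mul_ne_zero (EE_ne h) (pow_ne_zero _ (PP_ne' (qq_lt h) (nm_lt h)))

lemma PP_euler {q : ℂ} (hq : ‖q‖ < 1) : PP q (-q) * PP (q ^ 2) q = 1 := by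
  have h1 := PP_mul_neg hq q
  have h2 := PP_split hq q
  have hE : PP q q ≠ 0 := PP_ne' hq hq
  rw [← sq] at h2
  apply mul_left_cancel₀ hE
  rw [← mul_assoc, h1, h2]; ring

lemma theta_prod {τ : ℂ} (h : 0 < τ.im) : theta2 τ * theta3 τ * theta4 τ = 2 * etaDedekind τ ^ 3 := by
  have h1 := PP_mul_neg (qq_lt h) (nm τ)
  have h2 := PP_euler (qq_lt h)
  rw [← qq] at h1
  rw [← h1] at h2
  rw [theta2_prod h, theta3_prod h, theta4_prod h, eta3_eq]
  linear_combination 2 * cexp (π * I * τ / 4) * EE τ ^ 3 * (PP (qq τ) (-qq τ) * (PP (qq τ) (nm τ) * PP (qq τ) (-nm τ)) + 1) * h2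

lemma theta3_S {τ : ℂ} (h : 0 < τ.im) : theta3 (-1 / τ) = (-I * τ) ^ (1 / 2 : ℂ) * theta3 τ := by
  have hτ : τ ≠ 0 := by rintro rfl; simp at h
  have := jacobiTheta₂_functional_equation 0 τ
  have h0 : (-I * τ) ^ (1 / 2 : ℂ) ≠ 0 := by
    rw [Ne, cpow_eq_zero_iff]; simp [hτ]
  rw [theta3_jt, theta3_jt, this]; simp
  field_simp

lemma theta2_S {τ : ℂ} (h : 0 < τ.im) : theta2 (-1 / τ) = (-I * τ) ^ (1 / 2 : ℂ) * theta4 τ := by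
  have hτ : τ ≠ 0 := by rintro rfl; simp at h
  have := jacobiTheta₂_functional_equation (1/2) τ
  have h0 : (-I * τ) ^ (1 / 2 : ℂ) ≠ 0 := by
    rw [Ne, cpow_eq_zero_iff]; simp [hτ]
  rw [theta2_jt, theta4_jt, this, ← jacobiTheta₂_neg_left]
  have e1 : -(-1 / τ / 2) = 1 / 2 / τ := by ring
  have e2 : (π * I * (-1 / τ) / 4) = -π * I * (1 / 2) ^ 2 / τ := by ring
  rw [e1, e2]
  field_simp

lemma sqrt_pow4 (w : ℂ) (_ : w ≠ 0) : (w ^ (1 / 2 : ℂ)) ^ 4 = w ^ 2 := by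
  rw [← cpow_nat_mul]; norm_num

lemma theta2_S4 {τ : ℂ} (h : 0 < τ.im) : theta2 (-1 / τ) ^ 4 = -τ ^ 2 * theta4 τ ^ 4 := by
  have hτ : τ ≠ 0 := by rintro rfl; simp at h
  rw [theta2_S h, mul_pow, sqrt_pow4 _ (by simp [hτ]), mul_pow]; simp

lemma int_sq_par (n : ℤ) : (-1 : ℂ) ^ (n ^ 2) = (-1) ^ n := by
  rcases Int.even_or_odd n with h | h
  · rw [h.neg_one_zpow, (h.pow_of_ne_zero two_ne_zero).neg_one_zpow]
  · rw [h.neg_one_zpow, (h.pow).neg_one_zpow]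

lemma theta3_T (τ : ℂ) : theta3 (τ + 1) = theta4 τ := by
  rw [theta3, theta4]
  refine tsum_congr fun n => ?_
  rw [qp, qp, ← int_sq_par, ← cexp_pi_int, ← exp_add]; congr 1; push_cast; ring

lemma theta2_T (τ : ℂ) : theta2 (τ + 1) = cexp (π * I / 4) * theta2 τ := by
  rw [theta2, theta2, ← tsum_mul_left]
  refine tsum_congr fun n => ?_
  have : (1 : ℂ) = cexp (π * I * ((n ^ 2 + n : ℤ) : ℂ)) := by
    rw [cexp_pi_int, zpow_add₀ (by norm_num), int_sq_par, ← zpow_add₀ (by norm_num)]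
    rw [Even.neg_one_zpow ⟨n, rfl⟩]
  rw [qp, qp, ← exp_add]
  calc _ = cexp (π * I * ((n ^ 2 + n : ℤ) : ℂ)) * cexp (π * I / 4 + 2 * π * I * τ * (((n : ℂ) + 1 / 2) ^ 2 / 2)) := by
        rw [← exp_add]; congr 1; push_cast; ring
    _ = _ := by rw [← this, one_mul]

lemma theta2_T4 (τ : ℂ) : theta2 (τ + 1) ^ 4 = -theta2 τ ^ 4 := by
  rw [theta2_T, mul_pow, ← Complex.exp_nat_mul]
  have : ((4 : ℕ) * (π * I / 4) : ℂ) = π * I := by push_cast; ring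
  rw [this, exp_pi_mul_I]; ring


/-- reindexing (N,n) ↦ (N-n,n) -/
def convE : ℤ × ℤ ≃ ℤ × ℤ where
  toFun x := (x.1 - x.2, x.2)
  invFun x := (x.1 + x.2, x.2)
  left_inv x := by simp
  right_inv x := by simp

lemma conv_hasSum {f g : ℤ → ℂ} (hf : Summable fun n => ‖f n‖) (hg : Summable fun n => ‖g n‖) :
    (∀ N, Summable fun n => f (N - n) * g n) ∧
    HasSum (fun N => ∑' n, f (N - n) * g n) ((∑' n, f n) * ∑' n, g n) := by
  have h1 : Summable fun x : ℤ × ℤ => f x.1 * g x.2 := summable_mul_of_summable_norm hf hg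
  have h2 : Summable fun x : ℤ × ℤ => f (x.1 - x.2) * g x.2 := convE.summable_iff.2 h1
  refine ⟨fun N => h2.prod_factor N, ?_⟩
  rw [tsum_mul_tsum_of_summable_norm hf hg, ← convE.tsum_eq]
  exact h2.hasSum.prod_fiberwise fun N => (h2.prod_factor N).hasSum

lemma norm_one_sub_ge {p w : ℂ} (hp0 : p ≠ 0) (hp : ‖p‖ < 1) {m : ℤ} (hm : m ≠ 0) (hw : ‖w‖ = ‖p‖ ^ m) :
    1 - ‖p‖ ≤ ‖1 - w‖ := by
  have hpp : 0 < ‖p‖ := norm_pos_iff.2 hp0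
  rcases lt_or_gt_of_ne hm with h | h
  · have h1 : ‖p‖ ^ (-1 : ℤ) ≤ ‖p‖ ^ m := zpow_le_zpow_right_of_le_one₀ hpp hp.le (by omega)
    have h2 : ‖w‖ - ‖(1 : ℂ)‖ ≤ ‖1 - w‖ := by rw [norm_sub_rev]; exact norm_sub_norm_le _ _
    rw [norm_one, hw] at h2
    have h3 : 1 ≤ ‖p‖ ^ (-1 : ℤ) * ‖p‖ := by rw [zpow_neg_one, inv_mul_cancel₀ hpp.ne']
    rw [zpow_neg_one] at *
    nlinarith [sq_nonneg (‖p‖ - 1)]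
  · have h1 : ‖p‖ ^ m ≤ ‖p‖ ^ (1 : ℤ) := zpow_le_zpow_right_of_le_one₀ hpp hp.le (by omega)
    have h2 : ‖(1 : ℂ)‖ - ‖w‖ ≤ ‖1 - w‖ := norm_sub_norm_le _ _
    rw [norm_one, hw] at h2
    rw [zpow_one] at h1
    linarith

lemma one_sub_ne {p w : ℂ} (hp0 : p ≠ 0) (hp : ‖p‖ < 1) {m : ℤ} (hm : m ≠ 0) (hw : ‖w‖ = ‖p‖ ^ m) : 1 - w ≠ 0 := by
  rw [← norm_pos_iff]; linarith [norm_one_sub_ge hp0 hp hm hw]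

lemma inv_one_sub_le {p w : ℂ} (hp0 : p ≠ 0) (hp : ‖p‖ < 1) {m : ℤ} (hm : m ≠ 0) (hw : ‖w‖ = ‖p‖ ^ m) :
    ‖(1 - w)⁻¹‖ ≤ (1 - ‖p‖)⁻¹ := by
  rw [norm_inv]
  exact inv_anti₀ (by linarith) (norm_one_sub_ge hp0 hp hm hw)

lemma summ_theta {τ : ℂ} (h : 0 < τ.im) {y : ℂ} (hy : y ≠ 0) :
    Summable fun l : ℤ => ‖nm τ ^ (l ^ 2) * y ^ l‖ := by
  have := ((summable_jacobiTheta₂_term_iff (log y / (2 * π * I)) τ).2 h).norm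
  refine this.congr fun n => ?_
  rw [jt_term, mul_div_cancel₀ _ two_pi_I_ne_zero, exp_log hy]

lemma TPy {τ : ℂ} (h : 0 < τ.im) {y : ℂ} (hy : y ≠ 0) :
    ∑' l : ℤ, nm τ ^ (l ^ 2) * y ^ l = EE τ * PP (qq τ) (-(y * nm τ)) * PP (qq τ) (-(y⁻¹ * nm τ)) :=
  TPsum (nm_ne τ) (nm_lt h) hy (summ_theta h hy)

/-- t0 -/
def t0 (τ : ℂ) : ℂ := ∑' n : ℤ, (-1 : ℂ) ^ n * nm τ ^ (n ^ 2 + n) / (1 - nm τ ^ (2 * n + 1))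

lemma alt_zero {p : ℂ} : ∑' m : ℤ, (-1 : ℂ) ^ m * p ^ (m ^ 2 + m) = 0 := by
  have h1 : ∑' m : ℤ, (-1 : ℂ) ^ m * p ^ (m ^ 2 + m) = ∑' m : ℤ, -((-1 : ℂ) ^ m * p ^ (m ^ 2 + m)) := by
    rw [← (Equiv.subLeft (-1 : ℤ)).tsum_eq]
    refine tsum_congr fun m => ?_
    simp only [Equiv.subLeft_apply]
    have : (-1 : ℂ) ^ (-1 - m) = -(-1) ^ m := by
      rw [zpow_sub₀ (by norm_num), zpow_neg_one, div_eq_mul_inv, ← inv_zpow]; norm_num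
    rw [this, show (-1 - m) ^ 2 + (-1 - m) = m ^ 2 + m by ring]; ring
  rw [tsum_neg] at h1
  exact self_eq_neg.mp h1

lemma t0_coeff {τ : ℂ} (h : 0 < τ.im) {g : ℤ → ℂ} (hg : ∀ n, g n = (1 - nm τ ^ (2 * n + 1))⁻¹)
   (hs : ∀ N : ℤ, Summable fun n => (-1 : ℂ) ^ (N - n) * nm τ ^ ((N - n) ^ 2 - (N - n)) * g n) (N : ℤ) :
    ∑' n : ℤ, (-1 : ℂ) ^ (N - n) * nm τ ^ ((N - n) ^ 2 - (N - n)) * g n = (-1) ^ N * nm τ ^ (N ^ 2) * t0 τ := by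
  set p := nm τ with hpd
  have hp0 : p ≠ 0 := nm_ne τ
  have hp : ‖p‖ < 1 := nm_lt h
  have step : ∀ N : ℤ, ∑' n : ℤ, (-1 : ℂ) ^ (N + 1 - n) * p ^ ((N + 1 - n) ^ 2 - (N + 1 - n)) * g n =
      - p ^ (2 * N + 1) * ∑' n : ℤ, (-1 : ℂ) ^ (N - n) * p ^ ((N - n) ^ 2 - (N - n)) * g n := by
    intro N
    rw [neg_mul, eq_neg_iff_add_eq_zero, ← tsum_mul_left, ← (hs (N+1)).tsum_add ((hs N).mul_left _)]
    have hz : ∑' n : ℤ, -((-1 : ℂ) ^ (N - n) * p ^ ((N - n) ^ 2 + (N - n))) = 0 := by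
      have hh := (Equiv.subLeft N).tsum_eq (fun m : ℤ => (-1 : ℂ) ^ m * p ^ (m ^ 2 + m))
      simp only [Equiv.subLeft_apply] at hh
      rw [tsum_neg, hh, alt_zero, neg_zero]
    rw [← hz]
    refine tsum_congr fun n => ?_
    have hne : 1 - p ^ (2 * n + 1) ≠ 0 := one_sub_ne hp0 hp (m := 2 * n + 1) (by omega) (norm_zpow _ _)
    have e1 : (-1 : ℂ) ^ (N + 1 - n) = -(-1) ^ (N - n) := by
      rw [show N + 1 - n = (N - n) + 1 by ring, zpow_add₀ (by norm_num)]; simp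
    have e2 : (N + 1 - n) ^ 2 - (N + 1 - n) = (N - n) ^ 2 + (N - n) := by ring
    have e3 : p ^ (2 * N + 1) * p ^ ((N - n) ^ 2 - (N - n)) = p ^ ((N - n) ^ 2 + (N - n)) * p ^ (2 * n + 1) := by
      rw [← zpow_add₀ hp0, ← zpow_add₀ hp0]; congr 1; ring
    rw [e1, e2, hg]
    field_simp
    linear_combination e3
  have h0 : ∑' n : ℤ, (-1 : ℂ) ^ (0 - n) * p ^ ((0 - n) ^ 2 - (0 - n)) * g n = t0 τ := by
    rw [t0]
    refine tsum_congr fun n => ?_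
    rw [hg, ← hpd, div_eq_mul_inv]
    have : (-1 : ℂ) ^ (0 - n) = (-1) ^ n := by
      rw [zero_sub, zpow_neg, ← inv_zpow]; norm_num
    rw [this]; congr 3; ring
  have hodd : ∀ N : ℤ, (-1 : ℂ) ^ (N + 1) * p ^ ((N + 1) ^ 2) * t0 τ = - p ^ (2 * N + 1) * ((-1) ^ N * p ^ (N ^ 2) * t0 τ) := by
    intro N
    rw [show (N + 1) ^ 2 = (2 * N + 1) + N ^ 2 by ring, zpow_add₀ hp0 (2 * N + 1), zpow_add₀ (by norm_num)]; simp; ring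
  induction N using Int.induction_on with
  | zero => rw [h0]; simp
  | succ N ih => rw [step, ih, hodd]
  | pred N ih =>
    have s1 := step (-N - 1)
    have s2 := hodd (-N - 1)
    rw [show (-(N : ℤ) - 1 + 1) = -N by ring] at s1 s2
    rw [ih, s2] at s1
    exact (mul_left_cancel₀ (neg_ne_zero.2 (zpow_ne_zero _ hp0)) s1).symm



lemma S_bound {p : ℂ} (hp0 : p ≠ 0) (hp : ‖p‖ < 1) {x : ℝ} (hx0 : ‖p‖ < x) (hx1 : x < 1) :
    Summable (fun n : ℤ => ‖(x : ℂ) ^ n * (1 - p ^ (2 * n + 1))⁻¹‖) ∧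
    ‖(1 - (x : ℂ)) * (∑' n : ℤ, (x : ℂ) ^ n * (1 - p ^ (2 * n + 1))⁻¹) - 1‖ ≤ (1 - x) * (2 * (1 - ‖p‖)⁻¹ ^ 2) := by
  have hpp : 0 < ‖p‖ := norm_pos_iff.2 hp0
  have hx : 0 < x := hpp.trans hx0
  have hxc : (x : ℂ) ≠ 0 := by exact_mod_cast hx.ne'
  have hinv : ∀ n : ℕ, ‖(1 - p ^ (2 * n + 1))⁻¹‖ ≤ (1 - ‖p‖)⁻¹ := fun n =>
    inv_one_sub_le hp0 hp (m := 2 * n + 1) (by omega) (by rw [norm_pow, ← zpow_natCast]; push_cast; rfl)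
  have hC : 0 < (1 - ‖p‖)⁻¹ := inv_pos.2 (by linarith)
  have hcast : ∀ n : ℕ, p ^ (2 * (n : ℤ) + 1) = p ^ (2 * n + 1) := fun n => by
    rw [← zpow_natCast p]; push_cast; rfl
  have hnegx : ∀ n : ℕ, (x : ℂ) ^ (-((n : ℤ) + 1)) = ((x : ℂ) ^ (n + 1))⁻¹ := fun n => by
    rw [zpow_neg, ← zpow_natCast]; push_cast; rfl
  have hneg : ∀ n : ℕ, (1 - p ^ (2 * (-((n : ℤ) + 1)) + 1))⁻¹ = - (p ^ (2 * n + 1) * (1 - p ^ (2 * n + 1))⁻¹) := fun n => by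
    rw [show (2 * (-((n : ℤ) + 1)) + 1) = -((2 * n + 1 : ℕ) : ℤ) by push_cast; ring, zpow_neg, zpow_natCast]
    have h1 : 1 - p ^ (2 * n + 1) ≠ 0 := one_sub_ne hp0 hp (m := 2 * n + 1) (by omega) (by rw [norm_pow, ← zpow_natCast]; push_cast; rfl)
    have h2 : p ^ (2 * n + 1) ≠ 0 := pow_ne_zero _ hp0
    have h3 : 1 - (p ^ (2 * n + 1))⁻¹ ≠ 0 := by
      intro h; apply h1; field_simp at h; linear_combination -h
    have h4 : p ^ (2 * n + 1) - 1 ≠ 0 := fun h => h1 (by linear_combination -h)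
    generalize p ^ (2 * n + 1) = w at *
    rw [inv_eq_iff_eq_inv, inv_neg, mul_inv, inv_inv]
    field_simp; ring
  have hbp : ∀ n : ℕ, ‖p ^ (2 * n + 1)‖ ≤ ‖p‖ ^ n := fun n => by
    rw [norm_pow]; exact pow_le_pow_of_le_one hpp.le hp.le (by omega)
  have hxn : ∀ n : ℕ, ‖(x : ℂ) ^ n‖ ≤ 1 := fun n => by
    rw [norm_pow, norm_real, Real.norm_eq_abs, abs_of_pos hx]; exact pow_le_one₀ hx.le hx1.le
  have hbn : ∀ n : ℕ, ‖((x : ℂ) ^ (n + 1))⁻¹ * p ^ (2 * n + 1)‖ ≤ ‖p‖ ^ n := fun n => by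
    rw [norm_mul, norm_inv, norm_pow, norm_pow, norm_real, Real.norm_eq_abs, abs_of_pos hx,
      inv_mul_le_iff₀ (by positivity), show 2 * n + 1 = (n + 1) + n by ring, pow_add]
    gcongr
  have hgeo : Summable fun n : ℕ => ‖p‖ ^ n := summable_geometric_of_lt_one hpp.le hp
  have hgeox : Summable fun n : ℕ => x ^ n := summable_geometric_of_lt_one hx.le hx1
  have hsum : Summable (fun n : ℤ => ‖(x : ℂ) ^ n * (1 - p ^ (2 * n + 1))⁻¹‖) := by
    refine Summable.of_nat_of_neg_add_one ?_ ?_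
    · refine Summable.of_nonneg_of_le (fun _ => norm_nonneg _) (fun n => ?_) (hgeox.mul_right (1 - ‖p‖)⁻¹)
      rw [hcast, norm_mul, zpow_natCast, norm_pow, norm_real, Real.norm_eq_abs, abs_of_pos hx]
      gcongr
      exact hinv n
    · refine Summable.of_nonneg_of_le (fun _ => norm_nonneg _) (fun n => ?_) (hgeo.mul_right (1 - ‖p‖)⁻¹)
      rw [hneg, hnegx, mul_neg, norm_neg, ← mul_assoc, norm_mul]
      gcongr
      · exact hbn n
      · exact hinv n
  refine ⟨hsum, ?_⟩
  have h1 := HasSum.nat_add_neg_add_one hsum.of_norm.hasSum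
  set b : ℕ → ℂ := fun n => ((x : ℂ) ^ n * p ^ (2 * n + 1) - ((x : ℂ) ^ (n + 1))⁻¹ * p ^ (2 * n + 1)) * (1 - p ^ (2 * n + 1))⁻¹ with hb
  have hbb : ∀ n, ‖b n‖ ≤ ‖p‖ ^ n * (2 * (1 - ‖p‖)⁻¹) := fun n => by
    rw [hb]
    simp only [norm_mul]
    calc _ ≤ (‖p‖ ^ n + ‖p‖ ^ n) * (1 - ‖p‖)⁻¹ := by
          gcongr
          · refine (norm_sub_le _ _).trans (add_le_add ?_ (hbn n))
            rw [norm_mul]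
            calc _ ≤ 1 * ‖p‖ ^ n := by gcongr; exact hxn n; exact hbp n
              _ = _ := one_mul _
          · exact hinv n
      _ = _ := by ring
  have hgs : HasSum (fun n : ℕ => ‖p‖ ^ n * (2 * (1 - ‖p‖)⁻¹)) ((1 - ‖p‖)⁻¹ * (2 * (1 - ‖p‖)⁻¹)) :=
    (hasSum_geometric_of_lt_one hpp.le hp).mul_right _
  have hB : ‖∑' n, b n‖ ≤ (1 - ‖p‖)⁻¹ * (2 * (1 - ‖p‖)⁻¹) := tsum_of_norm_bounded hgs hbb
  have hbs : Summable b := Summable.of_norm_bounded hgs.summable hbb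
  have hx1' : ‖(x : ℂ)‖ < 1 := by rw [norm_real, Real.norm_eq_abs, abs_of_pos hx]; exact hx1
  have h2 : HasSum (fun n : ℕ => (x : ℂ) ^ n + b n) ((1 - (x : ℂ))⁻¹ + ∑' n, b n) :=
    (hasSum_geometric_of_norm_lt_one hx1').add hbs.hasSum
  have h3 : (∑' n : ℤ, (x : ℂ) ^ n * (1 - p ^ (2 * n + 1))⁻¹) = (1 - (x : ℂ))⁻¹ + ∑' n, b n := by
    refine h1.unique (h2.congr_fun fun n => ?_)
    rw [hcast, hneg, hnegx, zpow_natCast]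
    simp only [hb]
    have h1 : 1 - p ^ (2 * n + 1) ≠ 0 := one_sub_ne hp0 hp (m := 2 * n + 1) (by omega) (by rw [norm_pow, ← zpow_natCast]; push_cast; rfl)
    generalize p ^ (2 * n + 1) = w at *
    field_simp
    ring
  have h4 : (1 - (x : ℂ)) ≠ 0 := by
    rw [sub_ne_zero]; exact_mod_cast hx1.ne'
  rw [h3, mul_add, mul_inv_cancel₀ h4, add_sub_cancel_left, norm_mul]
  have h5 : ‖1 - (x : ℂ)‖ = 1 - x := by
    rw [← ofReal_one, ← ofReal_sub, norm_real, Real.norm_eq_abs, abs_of_pos (by linarith)]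
  rw [h5]
  refine mul_le_mul_of_nonneg_left (hB.trans (le_of_eq (by ring))) (by linarith)

lemma t0_theta4 {τ : ℂ} (h : 0 < τ.im) : t0 τ * theta4 τ = EE τ ^ 3 := by
  have hp0 := nm_ne τ
  have hp := nm_lt h
  set p := nm τ with hpd
  have hpp : 0 < ‖p‖ := norm_pos_iff.2 hp0
  have key : ∀ x : ℝ, ‖p‖ < x → x < 1 →
     EE τ * PP (qq τ) (x * qq τ) * PP (qq τ) ((x : ℂ)⁻¹ * qq τ) * ((1 - (x : ℂ)) * (∑' n : ℤ, (x : ℂ) ^ n * (1 - p ^ (2 * n + 1))⁻¹))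
       = t0 τ * (EE τ * PP (qq τ) (x * p) * PP (qq τ) ((x : ℂ)⁻¹ * p)) := by
    intro x hx0 hx1
    have hx : 0 < x := hpp.trans hx0
    have hxc : (x : ℂ) ≠ 0 := by exact_mod_cast hx.ne'
    have hy : -(x : ℂ) * p⁻¹ ≠ 0 := mul_ne_zero (neg_ne_zero.2 hxc) (inv_ne_zero hp0)
    have hgs := (S_bound hp0 hp hx0 hx1).1
    have hfs := summ_theta h hy
    obtain ⟨hc1, hc2⟩ := conv_hasSum hfs hgs
    have hterm : ∀ N n : ℤ, p ^ ((N - n) ^ 2) * (-(x : ℂ) * p⁻¹) ^ (N - n) * ((x : ℂ) ^ n * (1 - p ^ (2 * n + 1))⁻¹) =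
       (x : ℂ) ^ N * ((-1 : ℂ) ^ (N - n) * p ^ ((N - n) ^ 2 - (N - n)) * (1 - p ^ (2 * n + 1))⁻¹) := by
      intro N n
      have : (x : ℂ) ^ N = (x : ℂ) ^ (N - n) * (x : ℂ) ^ n := by rw [← zpow_add₀ hxc]; simp
      rw [this, mul_zpow, neg_eq_neg_one_mul, mul_zpow, inv_zpow, zpow_sub₀ hp0 ((N - n)^2)]
      field_simp
    rw [← hpd] at hc1 hc2
    simp_rw [hterm] at hc1 hc2
    have hco := t0_coeff h (g := fun n => (1 - p ^ (2 * n + 1))⁻¹) (fun n => rfl) (fun N =>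
      (summable_mul_left_iff (zpow_ne_zero N hxc)).1 (hc1 N))
    simp_rw [tsum_mul_left] at hc2
    simp_rw [← hpd] at hco
    simp_rw [hco] at hc2
    have hy2 : -(x : ℂ) ≠ 0 := neg_ne_zero.2 hxc
    have e1 := TPy h hy2
    have e2 := TPy h hy
    rw [← hpd] at e1 e2
    have e3 : ∑' N : ℤ, (x : ℂ) ^ N * ((-1 : ℂ) ^ N * p ^ (N ^ 2) * t0 τ) = t0 τ * ∑' l : ℤ, p ^ l ^ 2 * (-(x : ℂ)) ^ l := by
      rw [← tsum_mul_left]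
      refine tsum_congr fun N => ?_
      rw [neg_eq_neg_one_mul (x : ℂ), mul_zpow]; ring
    have e4 := hc2.tsum_eq
    rw [e3, e1, e2] at e4
    have e5 : -(-(x : ℂ) * p⁻¹ * p) = x := by field_simp
    have e6 : -((-(x : ℂ) * p⁻¹)⁻¹ * p) = (x : ℂ)⁻¹ * qq τ := by rw [qq, ← hpd, mul_inv, inv_inv, inv_neg]; ring
    have e7 : -(-(x : ℂ) * p) = x * p := by ring
    have e8 : -((-(x : ℂ))⁻¹ * p) = (x : ℂ)⁻¹ * p := by rw [inv_neg]; ring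
    rw [e5, e6, e7, e8, PP_succ (qq_lt h) x] at e4
    rw [e4]; ring
  have hcx : Tendsto (fun x : ℝ => (x : ℂ)) (𝓝[<] 1) (𝓝 1) := by
    have : Tendsto (fun x : ℝ => (x : ℂ)) (𝓝 1) (𝓝 ((1 : ℝ) : ℂ)) := continuous_ofReal.tendsto 1
    simpa using this.mono_left nhdsWithin_le_nhds
  have hcxi : Tendsto (fun x : ℝ => (x : ℂ)⁻¹) (𝓝[<] 1) (𝓝 1) := by
    simpa using hcx.inv₀ one_ne_zero
  have hP := PP_continuous (qq_lt h)
  have ev : ∀ᶠ x : ℝ in 𝓝[<] 1, ‖p‖ < x ∧ x < 1 := by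
    refine (eventually_nhdsWithin_of_eventually_nhds (lt_mem_nhds hp)).and self_mem_nhdsWithin
  have hS : Tendsto (fun x : ℝ => (1 - (x : ℂ)) * (∑' n : ℤ, (x : ℂ) ^ n * (1 - p ^ (2 * n + 1))⁻¹)) (𝓝[<] 1) (𝓝 1) := by
    rw [tendsto_iff_norm_sub_tendsto_zero]
    refine squeeze_zero' (Eventually.of_forall fun _ => norm_nonneg _) (ev.mono fun x hx => (S_bound hp0 hp hx.1 hx.2).2) ?_
    have : Tendsto (fun x : ℝ => (1 - x) * (2 * (1 - ‖p‖)⁻¹ ^ 2)) (𝓝 1) (𝓝 ((1 - 1) * (2 * (1 - ‖p‖)⁻¹ ^ 2))) :=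
      (Continuous.tendsto (by fun_prop) 1)
    simpa using this.mono_left nhdsWithin_le_nhds
  have hcomp : ∀ (c : ℂ) (u : ℝ → ℂ), Tendsto u (𝓝[<] 1) (𝓝 1) → Tendsto (fun x => PP (qq τ) (u x * c)) (𝓝[<] 1) (𝓝 (PP (qq τ) c)) := by
    intro c u hu
    have := (hP.tendsto (1 * c)).comp (hu.mul_const c)
    rwa [one_mul] at this
  have l1 := ((tendsto_const_nhds (x := EE τ)).mul (hcomp (qq τ) _ hcx)).mul (hcomp (qq τ) _ hcxi) |>.mul hS
  have l2 := (((tendsto_const_nhds (x := EE τ)).mul (hcomp p _ hcx)).mul (hcomp p _ hcxi)).const_mul (t0 τ)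
  have := tendsto_nhds_unique (l1.congr' (ev.mono fun x hx => key x hx.1 hx.2)) l2
  rw [theta4_prod h, ← hpd]
  rw [← EE] at this
  linear_combination -this


/-- F -/
def FF (τ : ℂ) : ℂ := ∑' n : ℤ, qp τ ((n : ℂ) ^ 2 / 2 - 1 / 8) / (1 + qp τ ((n : ℂ) - 1 / 2))
/-- B3 -/
def B3 (τ : ℂ) : ℂ := ∑' n : ℤ, nm τ ^ (n ^ 2) * (1 + nm τ ^ (2 * n - 1))⁻¹
/-- B4 -/
def B4 (τ : ℂ) : ℂ := ∑' n : ℤ, (-1 : ℂ) ^ n * nm τ ^ (n ^ 2) * (1 - nm τ ^ (2 * n - 1))⁻¹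

lemma nm_zpow (τ : ℂ) (n : ℤ) : nm τ ^ n = cexp (π * I * τ * n) := by
  rw [nm, ← exp_int_mul]; congr 1; ring

lemma FF_eq (τ : ℂ) : FF τ = cexp (-(π * I * τ / 4)) * B3 τ := by
  rw [FF, B3, ← tsum_mul_left]
  refine tsum_congr fun n => ?_
  rw [nm_zpow, nm_zpow, ← mul_assoc, ← exp_add, qp, qp, div_eq_mul_inv]
  congr 2
  · push_cast; ring
  · congr 2; push_cast; ring

lemma nm_add_one (τ : ℂ) : nm (τ + 1) = -nm τ := by
  rw [nm, nm, mul_add, exp_add, mul_one, exp_pi_mul_I]; ring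

lemma B3_T (τ : ℂ) : B3 (τ + 1) = B4 τ := by
  rw [B3, B4]
  refine tsum_congr fun n => ?_
  rw [nm_add_one, neg_eq_neg_one_mul, mul_zpow, mul_zpow, int_sq_par]
  rw [show (-1 : ℂ) ^ (2 * n - 1) = -1 from Odd.neg_one_zpow ⟨n - 1, by ring⟩]
  ring

lemma summ_B3 {τ : ℂ} (h : 0 < τ.im) : Summable fun n : ℤ => ‖nm τ ^ (n ^ 2) * (1 + nm τ ^ (2 * n - 1))⁻¹‖ := by
  have := summ_theta h (y := 1) one_ne_zero
  simp only [one_zpow, mul_one] at this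
  refine Summable.of_nonneg_of_le (fun _ => norm_nonneg _) (fun n => ?_) (this.mul_right (1 - ‖nm τ‖)⁻¹)
  rw [norm_mul]
  gcongr
  have := inv_one_sub_le (nm_ne τ) (nm_lt h) (m := 2 * n - 1) (by omega) (w := -nm τ ^ (2 * n - 1)) (by rw [norm_neg, norm_zpow])
  rwa [sub_neg_eq_add] at this

lemma summ_B4 {τ : ℂ} (h : 0 < τ.im) : Summable fun n : ℤ => ‖(-1 : ℂ) ^ n * nm τ ^ (n ^ 2) * (1 - nm τ ^ (2 * n - 1))⁻¹‖ := by
  have := summ_theta h (y := 1) one_ne_zero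
  simp only [one_zpow, mul_one] at this
  refine Summable.of_nonneg_of_le (fun _ => norm_nonneg _) (fun n => ?_) (this.mul_right (1 - ‖nm τ‖)⁻¹)
  rw [norm_mul, norm_mul, norm_zpow, norm_neg, norm_one, one_zpow, one_mul]
  gcongr
  exact inv_one_sub_le (nm_ne τ) (nm_lt h) (m := 2 * n - 1) (by omega) (norm_zpow _ _)

lemma theta3_nm (τ : ℂ) : theta3 τ = ∑' n : ℤ, nm τ ^ (n ^ 2) := by
  rw [theta3]; refine tsum_congr fun n => ?_
  rw [nm_zpow, qp]; congr 1; push_cast; ring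

lemma theta4_nm (τ : ℂ) : theta4 τ = ∑' n : ℤ, (-1 : ℂ) ^ n * nm τ ^ (n ^ 2) := by
  rw [theta4]; refine tsum_congr fun n => ?_
  rw [nm_zpow, qp]; congr 2; push_cast; ring

lemma theta2_nm (τ : ℂ) : theta2 τ = cexp (π * I * τ / 4) * ∑' n : ℤ, nm τ ^ (n ^ 2 - n) := by
  rw [theta2, ← tsum_mul_left, ← (Equiv.subRight (1 : ℤ)).tsum_eq]
  refine tsum_congr fun n => ?_
  rw [nm_zpow, qp, ← exp_add, Equiv.subRight_apply]; congr 1; push_cast; ring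

lemma D_pre {τ : ℂ} (h : 0 < τ.im) :
    theta3 τ * B4 τ - theta4 τ * B3 τ = -2 * nm τ * t0 (2 * τ) * ∑' n : ℤ, nm τ ^ (n ^ 2 - n) := by
  have hp0 := nm_ne τ
  have hp := nm_lt h
  have hth := summ_theta h (y := 1) one_ne_zero
  simp only [one_zpow, mul_one] at hth
  have hth4 : Summable fun n : ℤ => ‖(-1 : ℂ) ^ n * nm τ ^ (n ^ 2)‖ := by
    refine hth.congr fun n => ?_
    rw [norm_mul, norm_zpow (-1 : ℂ), norm_neg, norm_one, one_zpow, one_mul]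
  obtain ⟨a1, a2⟩ := conv_hasSum hth (summ_B4 h)
  obtain ⟨b1, b2⟩ := conv_hasSum hth4 (summ_B3 h)
  rw [← B4, ← theta3_nm] at a2
  rw [← B3, ← theta4_nm] at b2
  have hs := a2.sub b2
  set p := nm τ with hpd
  set y : ℤ → ℤ → ℂ := fun N n => p ^ ((N - n) ^ 2) * ((-1 : ℂ) ^ n * p ^ (n ^ 2) * (1 - p ^ (2 * n - 1))⁻¹) -
     (-1 : ℂ) ^ (N - n) * p ^ ((N - n) ^ 2) * (p ^ (n ^ 2) * (1 + p ^ (2 * n - 1))⁻¹) with hy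
  have ys : ∀ N, Summable (y N) := fun N => (a1 N).sub (b1 N)
  have hs2 : HasSum (fun N => ∑' n, y N n) (theta3 τ * B4 τ - theta4 τ * B3 τ) := by
    refine hs.congr_fun fun N => ?_
    exact ((a1 N).tsum_sub (b1 N))
  have hm1 : (-1 : ℂ) ≠ 0 := by norm_num
  have hneg : ∀ N n : ℤ, (-1 : ℂ) ^ (N - n) = (-1) ^ N * (-1) ^ n := fun N n => by
    rw [zpow_sub₀ hm1, div_eq_mul_inv, ← inv_zpow]; norm_num
  have h1m : ∀ n : ℤ, 1 - p ^ (2 * n - 1) ≠ 0 := fun n => one_sub_ne hp0 hp (m := 2 * n - 1) (by omega) (norm_zpow _ _)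
  have h1p : ∀ n : ℤ, 1 + p ^ (2 * n - 1) ≠ 0 := fun n => by
    have := one_sub_ne hp0 hp (m := 2 * n - 1) (by omega) (w := -p ^ (2 * n - 1)) (by rw [norm_neg, norm_zpow])
    rwa [sub_neg_eq_add] at this
  have hZ : ∀ N : ℤ, (1 + (-1) ^ N) * ∑' n : ℤ, (-1 : ℂ) ^ n * p ^ ((N + 1 - n) ^ 2 + n ^ 2) = 0 := by
    intro N
    have : ∑' n : ℤ, (-1 : ℂ) ^ n * p ^ ((N + 1 - n) ^ 2 + n ^ 2) = -((-1) ^ N) * ∑' n : ℤ, (-1 : ℂ) ^ n * p ^ ((N + 1 - n) ^ 2 + n ^ 2) := by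
      conv_lhs => rw [← (Equiv.subLeft (N + 1)).tsum_eq]
      rw [← tsum_mul_left]
      refine tsum_congr fun n => ?_
      simp only [Equiv.subLeft_apply]
      rw [hneg, zpow_add₀ hm1, show (N + 1 - (N + 1 - n)) ^ 2 + (N + 1 - n) ^ 2 = (N + 1 - n) ^ 2 + n ^ 2 by ring]; simp; ring
    linear_combination this
  have step : ∀ N, ∑' n, y (N + 1) n = p ^ (2 * N) * ∑' n, y N n := by
    intro N
    rw [← sub_eq_zero, ← tsum_mul_left, ← (ys (N+1)).tsum_sub ((ys N).mul_left _), ← hZ N, ← tsum_mul_left]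
    refine tsum_congr fun n => ?_
    simp only [hy]
    rw [hneg, hneg, zpow_add₀ hm1, zpow_one]
    have e1 : p ^ ((N + 1 - n) ^ 2 + n ^ 2) = p ^ ((N + 1 - n) ^ 2) * p ^ (n ^ 2) := zpow_add₀ hp0 _ _
    have e2 : p ^ (2 * N) * p ^ ((N - n) ^ 2) = p ^ ((N + 1 - n) ^ 2) * p ^ (2 * n - 1) := by
      rw [← zpow_add₀ hp0, ← zpow_add₀ hp0]; congr 1; ring
    have i1 : (1 - p ^ (2 * n - 1)) * (1 - p ^ (2 * n - 1))⁻¹ = 1 := mul_inv_cancel₀ (h1m n)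
    have i2 : (1 + p ^ (2 * n - 1)) * (1 + p ^ (2 * n - 1))⁻¹ = 1 := mul_inv_cancel₀ (h1p n)
    rw [e1]
    generalize (1 - p ^ (2 * n - 1))⁻¹ = u at *
    generalize (1 + p ^ (2 * n - 1))⁻¹ = v at *
    generalize p ^ (2 * n - 1) = P at *
    generalize p ^ ((N + 1 - n) ^ 2) = r at *
    generalize p ^ ((N - n) ^ 2) = s at *
    linear_combination (-1 : ℂ) ^ n * p ^ (n ^ 2) * (-(u - (-1 : ℂ) ^ N * v) * e2 + r * i1 + r * (-1 : ℂ) ^ N * i2)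
  have hY1 : ∑' n, y 1 n = -2 * p * t0 (2 * τ) := by
    rw [← (Equiv.addRight (1 : ℤ)).tsum_eq, t0, ← tsum_mul_left]
    refine tsum_congr fun n => ?_
    have hp2 : nm (2 * τ) = p ^ 2 := by
      rw [hpd, nm, nm, ← Complex.exp_nat_mul]; congr 1; push_cast; ring
    simp only [Equiv.coe_addRight, hy]
    have i1 := h1m (n + 1)
    have i2 := h1p (n + 1)
    rw [show 2 * (n + 1) - 1 = 2 * n + 1 by ring] at *
    have e1 : nm (2 * τ) ^ (2 * n + 1) = (p ^ (2 * n + 1)) ^ 2 := by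
      rw [hp2, ← zpow_natCast, ← zpow_natCast, ← zpow_mul, ← zpow_mul]; congr 1; ring
    have e2 : p ^ ((1 - (n + 1)) ^ 2) * p ^ ((n + 1) ^ 2) = p * nm (2 * τ) ^ (n ^ 2 + n) := by
      rw [hp2, ← zpow_natCast, ← zpow_mul, ← zpow_add₀ hp0]
      nth_rewrite 2 [← zpow_one p]
      rw [← zpow_add₀ hp0]; congr 1; push_cast; ring
    rw [hneg, zpow_add₀ hm1, zpow_one, e1]
    generalize p ^ (2 * n + 1) = P at *
    generalize p ^ ((1 - (n + 1)) ^ 2) = r at *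
    generalize p ^ ((n + 1) ^ 2) = s at *
    generalize nm (2 * τ) ^ (n ^ 2 + n) = t at *
    have i3 : 1 - P ^ 2 ≠ 0 := by
      rw [show 1 - P ^ 2 = (1 - P) * (1 + P) by ring]; exact mul_ne_zero i1 i2
    field_simp
    linear_combination -2 * (1 - P ^ 2) * e2
  have hYN : ∀ N : ℤ, ∑' n, y N n = p ^ (N ^ 2 - N) * (-2 * p * t0 (2 * τ)) := by
    have hst : ∀ N : ℤ, p ^ ((N + 1) ^ 2 - (N + 1)) = p ^ (2 * N) * p ^ (N ^ 2 - N) := fun N => by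
      rw [← zpow_add₀ hp0]; congr 1; ring
    have h0 : ∑' n, y 0 n = -2 * p * t0 (2 * τ) := by
      have := step 0
      simp only [zero_add, mul_zero, zpow_zero, one_mul] at this
      rw [← this, hY1]
    intro N
    induction N using Int.induction_on with
    | zero => rw [h0]; simp
    | succ N ih => rw [step, ih, hst]; ring
    | pred N ih =>
      have s1 := step (-N - 1)
      have s2 := hst (-N - 1)
      rw [show (-(N : ℤ) - 1 + 1) = -N by ring] at s1 s2
      rw [ih, s2] at s1
      exact mul_left_cancel₀ (zpow_ne_zero _ hp0) (by linear_combination -s1)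
  rw [← hs2.tsum_eq, ← tsum_mul_left]
  exact tsum_congr fun N => by rw [hYN]; ring

lemma t0_two {τ : ℂ} (h : 0 < τ.im) : 4 * nm τ * t0 (2 * τ) = cexp (π * I * τ / 4) ^ 2 * theta2 τ ^ 2 := by
  have h2 : 0 < (2 * τ).im := by simp [h]
  have h1 := t0_theta4 h2
  have hq := qq_lt h
  have hnm2 : nm (2 * τ) = qq τ := by
      rw [qq, nm, nm, ← Complex.exp_nat_mul]; congr 1; push_cast; ring
  have hqq2 : qq (2 * τ) = qq τ ^ 2 := by rw [qq, hnm2]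
  have hE2 : EE (2 * τ) = EE τ * PP (qq τ) (-qq τ) := by
    rw [EE, EE, hqq2, ← PP_mul_neg hq]
  have heu := PP_euler hq
  rw [theta4_prod h2, hqq2, hnm2] at h1
  have hE := EE_ne h2
  have h3 : t0 (2 * τ) * PP (qq τ ^ 2) (qq τ) ^ 2 = EE (2 * τ) ^ 2 := by
    apply mul_left_cancel₀ hE; linear_combination h1
  have h4 : t0 (2 * τ) = EE (2 * τ) ^ 2 * PP (qq τ) (-qq τ) ^ 2 := by
    rw [← h3]
    linear_combination -t0 (2 * τ) * (PP (qq τ) (-qq τ) * PP (qq τ ^ 2) (qq τ) + 1) * heu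
  have hp : nm τ = cexp (π * I * τ / 4) ^ 4 := by
    rw [nm, ← Complex.exp_nat_mul]; congr 1; push_cast; ring
  rw [h4, hE2, theta2_prod h, hp]; ring

lemma D_id {τ : ℂ} (h : 0 < τ.im) :
    theta3 τ * B4 τ - theta4 τ * B3 τ = -cexp (π * I * τ / 4) * theta2 τ ^ 3 / 2 := by
  have h1 := D_pre h
  have h2 := t0_two h
  have h3 := theta2_nm τ
  rw [h1]
  have hc : cexp (π * I * τ / 4) ≠ 0 := exp_ne_zero _
  apply mul_left_cancel₀ hc
  linear_combination (-1/2) * theta2 τ * h2 + 2 * nm τ * t0 (2 * τ) * h3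


lemma eta_term_bound {δ : ℝ} (hδ : 0 < δ) {w : ℂ} (hw : δ ≤ w.im) (n : ℕ) :
    ‖(-1 : ℂ) ^ n * (2 * n + 1) * cexp (π * I * w * (n + 1 / 2) ^ 2)‖ ≤
      ((2 * n + 1) * Real.exp (-(π * δ)) ^ n) * Real.exp (-(π * w.im / 4)) := by
  have hre : (π * I * w * (n + 1 / 2) ^ 2 : ℂ).re = -(π * w.im * (n + 1 / 2) ^ 2) := by
    have : (π * I * w * (n + 1 / 2) ^ 2 : ℂ) = ((π * (n + 1 / 2) ^ 2 : ℝ) : ℂ) * (I * w) := by push_cast; ring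
    rw [this, re_ofReal_mul]; simp; ring
  rw [norm_mul, norm_mul, norm_pow, norm_neg, norm_one, one_pow, one_mul, norm_exp, hre]
  have h1 : ‖(2 * n + 1 : ℂ)‖ = 2 * n + 1 := by
    have : (2 * n + 1 : ℂ) = ((2 * n + 1 : ℝ) : ℂ) := by push_cast; ring
    rw [this, norm_real, Real.norm_eq_abs, abs_of_pos (by positivity)]
  rw [h1, mul_assoc (2 * (n : ℝ) + 1), ← Real.exp_nat_mul, ← Real.exp_add]
  gcongr
  have hpi := Real.pi_pos
  have hn : (0 : ℝ) ≤ n := Nat.cast_nonneg n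
  have e1 : π * (n * δ) ≤ π * (n * w.im) := by gcongr
  have e2 : 0 ≤ π * w.im * n ^ 2 := by have := hδ.le.trans hw; positivity
  nlinarith

lemma eta_u_summable {δ : ℝ} (hδ : 0 < δ) : Summable fun n : ℕ => ((2 * n + 1) * Real.exp (-(π * δ)) ^ n) := by
  have hr : ‖Real.exp (-(π * δ))‖ < 1 := by
    rw [Real.norm_eq_abs, abs_of_pos (Real.exp_pos _), Real.exp_lt_one_iff]
    have := Real.pi_pos; have : 0 < π * δ := by positivity
    linarith
  have h1 := (summable_pow_mul_geometric_of_norm_lt_one 1 hr).mul_left 2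
  have h2 := summable_pow_mul_geometric_of_norm_lt_one 0 hr
  refine (h1.add h2).congr fun n => by ring

lemma eta3_bound {δ : ℝ} (hδ : 0 < δ) : ∃ C : ℝ, 0 < C ∧ ∀ w : ℂ, δ ≤ w.im → ‖etaDedekind w ^ 3‖ ≤ C * Real.exp (-(π * w.im / 4)) := by
  refine ⟨1 + ∑' n : ℕ, ((2 * n + 1) * Real.exp (-(π * δ)) ^ n), ?_, fun w hw => ?_⟩
  · have : 0 ≤ ∑' n : ℕ, ((2 * n + 1) * Real.exp (-(π * δ)) ^ n) := tsum_nonneg fun n => by positivity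
    linarith
  · rw [← (hasSum_eta3 (hδ.trans_le hw)).tsum_eq]
    refine (tsum_of_norm_bounded ((eta_u_summable hδ).hasSum.mul_right _) (eta_term_bound hδ hw)).trans ?_
    gcongr
    linarith

lemma eta3_diffAt {w : ℂ} (hw : 0 < w.im) : DifferentiableAt ℂ (fun w => etaDedekind w ^ 3) w := by
  set δ := w.im / 2
  have hδ : 0 < δ := half_pos hw
  have hopen : IsOpen {z : ℂ | δ < z.im} := isOpen_lt continuous_const continuous_im
  have h1 : DifferentiableOn ℂ (fun z => ∑' n : ℕ, (-1 : ℂ) ^ n * (2 * n + 1) * cexp (π * I * z * (n + 1 / 2) ^ 2)) {z : ℂ | δ < z.im} := by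
    refine differentiableOn_tsum_of_summable_norm (eta_u_summable hδ) (fun n => ?_) hopen (fun n z hz => ?_)
    · exact Differentiable.differentiableOn (by fun_prop)
    · refine (eta_term_bound hδ (le_of_lt hz) n).trans ?_
      refine mul_le_of_le_one_right (by positivity) ?_
      rw [Real.exp_le_one_iff]
      have : 0 < z.im := hδ.trans hz
      have := Real.pi_pos
      have : 0 < π * z.im / 4 := by positivity
      linarith
  have hmem : {z : ℂ | δ < z.im} ∈ 𝓝 w := hopen.mem_nhds (half_lt_self hw)
  refine (h1.differentiableAt hmem).congr_of_eventuallyEq ?_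
  filter_upwards [hmem] with z hz
  exact (hasSum_eta3 (hδ.trans hz)).tsum_eq.symm

/-- η³(ix) -/
def NN (x : ℝ) : ℝ := ∑' n : ℕ, (-1 : ℝ) ^ n * (2 * n + 1) * Real.exp (-(π * (n + 1 / 2) ^ 2 * x))

lemma Ix_im (x : ℝ) : (I * x : ℂ).im = x := by simp

lemma hasSum_NN {x : ℝ} (hx : 0 < x) : HasSum (fun n : ℕ => (-1 : ℝ) ^ n * (2 * n + 1) * Real.exp (-(π * (n + 1 / 2) ^ 2 * x))) (NN x)
    ∧ (NN x : ℂ) = etaDedekind (I * x) ^ 3 := by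
  have h := hasSum_eta3 (τ := I * x) (by simpa using hx)
  have h2 : HasSum (fun n : ℕ => (((-1 : ℝ) ^ n * (2 * n + 1) * Real.exp (-(π * (n + 1 / 2) ^ 2 * x)) : ℝ) : ℂ)) (etaDedekind (I * x) ^ 3) := by
    refine h.congr_fun fun n => ?_
    push_cast
    congr 2
    linear_combination -π * x * (n + 1 / 2) ^ 2 * I_sq
  have h3 := h2.summable
  rw [Complex.summable_ofReal] at h3
  refine ⟨h3.hasSum, ?_⟩
  rw [NN, ofReal_tsum]
  exact h2.tsum_eq

lemma NN_S {x : ℝ} (hx : 0 < x) : NN x⁻¹ = x ^ (3 / 2 : ℝ) * NN x := by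
  have hxc : (x : ℂ) ≠ 0 := by exact_mod_cast hx.ne'
  have h := eta3_S (τ := I * x) (by simpa using hx)
  have e1 : -I * (I * x) = (x : ℂ) := by linear_combination -x * I_sq
  have e2 : -1 / (I * x) = I * ((x⁻¹ : ℝ) : ℂ) := by
    have := I_ne_zero
    push_cast; field_simp; rw [I_sq]
  rw [e1, e2, ← (hasSum_NN hx).2, ← (hasSum_NN (inv_pos.2 hx)).2] at h
  have e3 : (x : ℂ) ^ (1 / 2 : ℂ) = ((x ^ (1 / 2 : ℝ) : ℝ) : ℂ) := by
    rw [ofReal_cpow hx.le]; norm_num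
  rw [e3] at h
  have h' : NN x = x⁻¹ * (x ^ (1 / 2 : ℝ))⁻¹ * NN x⁻¹ := by exact_mod_cast h
  have e4 : x ^ (3 / 2 : ℝ) = x * x ^ (1 / 2 : ℝ) := by
    rw [show (3 / 2 : ℝ) = 1 + 1 / 2 by norm_num, Real.rpow_add hx, Real.rpow_one]
  have := Real.rpow_pos_of_pos hx (1 / 2)
  rw [h', e4]; field_simp

lemma NN_cont : ContinuousOn NN (Set.Ioi 0) := by
  have : Set.EqOn NN (fun x => (etaDedekind (I * x) ^ 3).re) (Set.Ioi 0) := fun x hx => by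
    simp only [← (hasSum_NN hx).2, ofReal_re]
  refine ContinuousOn.congr ?_ this
  intro x hx
  have h1 : ContinuousAt (fun w => etaDedekind w ^ 3) (I * (x : ℂ)) := (eta3_diffAt (by simpa using hx)).continuousAt
  have h2 : ContinuousAt (fun x : ℝ => I * (x : ℂ)) x := by fun_prop
  exact (continuous_re.continuousAt.comp (ContinuousAt.comp (f := fun x : ℝ => I * (x : ℂ)) (g := fun w => etaDedekind w ^ 3) h1 h2)).continuousWithinAt

lemma NN_bound : ∃ C : ℝ, 0 < C ∧ ∀ x : ℝ, 0 < x → |NN x| ≤ C * (x * Real.exp (-(x / 2))) := by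
  obtain ⟨C, hC, hb⟩ := eta3_bound one_pos
  have hb' : ∀ x : ℝ, 1 ≤ x → |NN x| ≤ C * Real.exp (-(π * x / 4)) := fun x hx => by
    have := hb (I * x) (by simpa using hx)
    rw [← (hasSum_NN (zero_lt_one.trans_le hx)).2, norm_real, Real.norm_eq_abs] at this
    simpa using this
  have hpi := Real.pi_gt_three
  refine ⟨C * 100, by positivity, fun x hx => ?_⟩
  rcases le_total 1 x with h | h
  · refine (hb' x h).trans ?_
    rw [mul_assoc]
    refine mul_le_mul_of_nonneg_left ?_ hC.le
    have h1 : Real.exp (-(π * x / 4)) ≤ Real.exp (-(x / 2)) := Real.exp_le_exp.2 (by nlinarith)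
    have h2 := Real.exp_pos (-(x / 2))
    nlinarith
  · have hxi : 1 ≤ x⁻¹ := (one_le_inv₀ hx).2 h
    have h1 := NN_S (inv_pos.2 hx)
    rw [inv_inv] at h1
    rw [h1, abs_mul, abs_of_pos (Real.rpow_pos_of_pos (inv_pos.2 hx) _)]
    have h2 := hb' _ hxi
    have h3 : x⁻¹ ^ (3 / 2 : ℝ) ≤ x⁻¹ ^ 2 := by
      rw [← Real.rpow_natCast]; exact Real.rpow_le_rpow_of_exponent_le hxi (by norm_num)
    have hv : 0 < π * x⁻¹ / 4 := by positivity
    have h4 : Real.exp (-(π * x⁻¹ / 4)) ≤ 16 * x ^ 3 := by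
      rw [Real.exp_neg]
      have := Real.pow_div_factorial_le_exp (π * x⁻¹ / 4) hv.le 3
      have h5 : (x⁻¹) ^ 3 / 16 ≤ (π * x⁻¹ / 4) ^ 3 / (Nat.factorial 3) := by
        rw [show (π * x⁻¹ / 4) ^ 3 / (Nat.factorial 3 : ℝ) = π ^ 3 / 384 * x⁻¹ ^ 3 by simp [Nat.factorial]; ring]
        have : (27 : ℝ) ≤ π ^ 3 := by nlinarith [sq_nonneg (π - 3)]
        have : 0 < x⁻¹ ^ 3 := by positivity
        nlinarith
      calc _ ≤ ((x⁻¹) ^ 3 / 16)⁻¹ := inv_anti₀ (by positivity) (h5.trans this)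
        _ = 16 * x ^ 3 := by field_simp
    have h6 : (1 / 2 : ℝ) ≤ Real.exp (-(x / 2)) := by
      have := Real.add_one_le_exp (-(x / 2)); linarith
    calc _ ≤ x⁻¹ ^ 2 * (C * (16 * x ^ 3)) := by gcongr; exact h2.trans (by gcongr)
      _ = C * (16 * x) := by field_simp
      _ ≤ _ := by
        rw [mul_assoc]
        refine mul_le_mul_of_nonneg_left ?_ hC.le
        nlinarith


def GG (v : ℝ) : ℝ := ∫ u in (0:ℝ)..v, Real.exp (-π * u ^ 2)

lemma GG_deriv (v : ℝ) : HasDerivAt GG (Real.exp (-π * v ^ 2)) v := by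
  have hc : Continuous fun u : ℝ => Real.exp (-π * u ^ 2) := by fun_prop
  exact intervalIntegral.integral_hasDerivAt_right (hc.intervalIntegrable _ _) (hc.stronglyMeasurableAtFilter _ _) hc.continuousAt

lemma GG_top : Tendsto GG atTop (𝓝 (1 / 2)) := by
  have h := intervalIntegral_tendsto_integral_Ioi 0 ((integrable_exp_neg_mul_sq Real.pi_pos).integrableOn (s := Set.Ioi 0)) tendsto_id
  rw [integral_gaussian_Ioi, div_self Real.pi_pos.ne', Real.sqrt_one] at h
  exact h

lemma GG_odd (v : ℝ) : GG (-v) = -GG v := by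
  unfold GG
  have := intervalIntegral.integral_comp_neg (a := 0) (b := v) (fun u => Real.exp (-π * u ^ 2))
  simp only [neg_sq, neg_zero] at this
  rw [this, intervalIntegral.integral_symm]

lemma GG_bot : Tendsto GG atBot (𝓝 (-(1 / 2))) := by
  have := (GG_top.comp tendsto_neg_atBot_atTop).neg
  refine this.congr fun v => ?_
  simp [GG_odd]

/-- key integral -/
lemma key_int {m y : ℝ} (hm : 0 < m) (hy : 0 < y) :
    IntegrableOn (fun x : ℝ => (√x)⁻¹ * Real.exp (-(π * m ^ 2 * x) - π * y ^ 2 / x)) (Set.Ioi 0) ∧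
    ∫ x in Set.Ioi (0:ℝ), (√x)⁻¹ * Real.exp (-(π * m ^ 2 * x) - π * y ^ 2 / x) = Real.exp (-(2 * π * m * y)) / m := by
  set Φ : ℝ → ℝ := fun x => (Real.exp (-(2 * π * m * y)) * GG (m * √x - y / √x) + Real.exp (2 * π * m * y) * GG (m * √x + y / √x)) / m with hΦ
  set l0 : ℝ := (Real.exp (-(2 * π * m * y)) * (-(1 / 2)) + Real.exp (2 * π * m * y) * (1 / 2)) / m
  set l1 : ℝ := (Real.exp (-(2 * π * m * y)) * (1 / 2) + Real.exp (2 * π * m * y) * (1 / 2)) / m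
  set Ψ := Function.update Φ 0 l0
  have hs0 : Tendsto (fun x : ℝ => √x) (𝓝[>] 0) (𝓝[>] 0) := by
    refine tendsto_nhdsWithin_iff.2 ⟨?_, ?_⟩
    · have : Tendsto (fun x : ℝ => √x) (𝓝 0) (𝓝 (√0)) := Real.continuous_sqrt.continuousAt
      rw [Real.sqrt_zero] at this
      exact this.mono_left nhdsWithin_le_nhds
    · filter_upwards [self_mem_nhdsWithin] with x hx using Real.sqrt_pos.2 hx
  have hdiv0 : Tendsto (fun x : ℝ => y / √x) (𝓝[>] 0) atTop := by
    simp_rw [div_eq_mul_inv]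
    exact (tendsto_inv_nhdsGT_zero.comp hs0).const_mul_atTop hy
  have hmul0 : Tendsto (fun x : ℝ => m * √x) (𝓝[>] 0) (𝓝 0) := by
    have := (hs0.mono_right nhdsWithin_le_nhds).const_mul m
    simpa using this
  have hΦ0 : Tendsto Φ (𝓝[>] 0) (𝓝 l0) := by
    have a1 : Tendsto (fun x : ℝ => m * √x - y / √x) (𝓝[>] 0) atBot := by
      simp_rw [sub_eq_add_neg]
      exact hmul0.add_atBot (tendsto_neg_atTop_atBot.comp hdiv0)
    have a2 : Tendsto (fun x : ℝ => m * √x + y / √x) (𝓝[>] 0) atTop := hmul0.add_atTop hdiv0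
    exact (((GG_bot.comp a1).const_mul _).add ((GG_top.comp a2).const_mul _)).div_const _
  have hΦ1 : Tendsto Φ atTop (𝓝 l1) := by
    have b1 : Tendsto (fun x : ℝ => m * √x) atTop atTop := Real.tendsto_sqrt_atTop.const_mul_atTop hm
    have b2 : Tendsto (fun x : ℝ => y / √x) atTop (𝓝 0) := Real.tendsto_sqrt_atTop.const_div_atTop y
    have a1 : Tendsto (fun x : ℝ => m * √x - y / √x) atTop atTop := by
      simp_rw [sub_eq_add_neg]
      exact b1.atTop_add b2.neg
    have a2 : Tendsto (fun x : ℝ => m * √x + y / √x) atTop atTop := b1.atTop_add b2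
    exact (((GG_top.comp a1).const_mul _).add ((GG_top.comp a2).const_mul _)).div_const _
  have hcont : ContinuousWithinAt Ψ (Set.Ici 0) 0 := by
    rw [continuousWithinAt_update_same]
    simpa using hΦ0
  have hderiv : ∀ x ∈ Set.Ioi (0:ℝ), HasDerivAt Ψ ((√x)⁻¹ * Real.exp (-(π * m ^ 2 * x) - π * y ^ 2 / x)) x := by
    intro x hx
    have hx : 0 < x := hx
    have hsx : 0 < √x := Real.sqrt_pos.2 hx
    have hsq : √x ^ 2 = x := Real.sq_sqrt hx.le
    have d0 := Real.hasDerivAt_sqrt hx.ne'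
    have d1 := (d0.const_mul m).sub ((hasDerivAt_const x y).div d0 hsx.ne')
    have d2 := (d0.const_mul m).add ((hasDerivAt_const x y).div d0 hsx.ne')
    have e1 := ((GG_deriv _).comp x d1).const_mul (Real.exp (-(2 * π * m * y)))
    have e2 := ((GG_deriv _).comp x d2).const_mul (Real.exp (2 * π * m * y))
    have e3 := (e1.add e2).div_const m
    have f1 : Real.exp (-(2 * π * m * y)) * Real.exp (-π * (m * √x - y / √x) ^ 2) = Real.exp (-(π * m ^ 2 * x) - π * y ^ 2 / x) := by
      rw [← Real.exp_add]; congr 1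
      rw [← hsq]; field_simp; rw [Real.sqrt_sq hsx.le]; ring
    have f2 : Real.exp ((2 * π * m * y)) * Real.exp (-π * (m * √x + y / √x) ^ 2) = Real.exp (-(π * m ^ 2 * x) - π * y ^ 2 / x) := by
      rw [← Real.exp_add]; congr 1
      rw [← hsq]; field_simp; rw [Real.sqrt_sq hsx.le]; ring
    have hval : (√x)⁻¹ * Real.exp (-(π * m ^ 2 * x) - π * y ^ 2 / x) = (Real.exp (-(2 * π * m * y)) * (Real.exp (-π * (m * √x - y / √x) ^ 2) * (m * (1 / (2 * √x)) - (0 * √x - y * (1 / (2 * √x))) / √x ^ 2)) + Real.exp (2 * π * m * y) * (Real.exp (-π * (m * √x + y / √x) ^ 2) * (m * (1 / (2 * √x)) + (0 * √x - y * (1 / (2 * √x))) / √x ^ 2))) / m := by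
      rw [← mul_assoc, ← mul_assoc, f1, f2]
      field_simp; ring
    rw [hval]
    refine HasDerivAt.congr_of_eventuallyEq e3 ?_
    filter_upwards [lt_mem_nhds hx] with z hz
    simp [Ψ, Function.update_of_ne hz.ne', hΦ]
  have hpos : ∀ x ∈ Set.Ioi (0:ℝ), 0 ≤ (√x)⁻¹ * Real.exp (-(π * m ^ 2 * x) - π * y ^ 2 / x) := fun x _ => by positivity
  have hΨ1 : Tendsto Ψ atTop (𝓝 l1) := by
    refine hΦ1.congr' ?_
    filter_upwards [eventually_gt_atTop 0] with z hz
    simp [Ψ, Function.update_of_ne hz.ne']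
  refine ⟨integrableOn_Ioi_deriv_of_nonneg hcont hderiv hpos hΨ1, ?_⟩
  rw [integral_Ioi_of_hasDerivAt_of_nonneg hcont hderiv hpos hΨ1]
  simp only [Ψ, Function.update_self, l0, l1]
  ring


def sech (y : ℝ) : ℝ := (Real.cosh (π * y))⁻¹

lemma sech_cont : Continuous sech := by
  unfold sech
  exact (Real.continuous_cosh.comp (by fun_prop)).inv₀ fun y => (Real.cosh_pos _).ne'

lemma sech_pos (y : ℝ) : 0 < sech y := inv_pos.2 (Real.cosh_pos _)
lemma sech_le_one (y : ℝ) : sech y ≤ 1 := inv_le_one_of_one_le₀ (Real.one_le_cosh _)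

lemma sech_neg (y : ℝ) : sech (-y) = sech y := by simp [sech]

lemma sech_hasSum {y : ℝ} (hy : 0 < y) : HasSum (fun n : ℕ => (-1 : ℝ) ^ n * (2 * Real.exp (-(π * y * (2 * n + 1))))) (sech y) := by
  have hpi := Real.pi_pos
  have hlt : |-(Real.exp (-(2 * π * y)))| < 1 := by
    rw [abs_neg, abs_of_pos (Real.exp_pos _), Real.exp_lt_one_iff]
    have : 0 < 2 * π * y := by positivity
    linarith
  have h := (hasSum_geometric_of_abs_lt_one hlt).mul_left (2 * Real.exp (-(π * y)))
  have e : sech y = 2 * Real.exp (-(π * y)) * (1 - -Real.exp (-(2 * π * y)))⁻¹ := by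
    have h1 : Real.exp (-(2 * π * y)) = Real.exp (-(π * y)) ^ 2 := by rw [← Real.exp_nat_mul]; congr 1; push_cast; ring
    have h2 : Real.exp (π * y) = (Real.exp (-(π * y)))⁻¹ := by rw [Real.exp_neg, inv_inv]
    rw [sech, Real.cosh_eq, h1, h2, sub_neg_eq_add]
    have := Real.exp_pos (-(π * y))
    have : 1 + Real.exp (-(π * y)) ^ 2 ≠ 0 := by positivity
    field_simp
  rw [e]
  refine h.congr_fun fun n => ?_
  rw [neg_pow (Real.exp _), ← Real.exp_nat_mul]
  have : Real.exp (-(π * y * (2 * n + 1))) = Real.exp (-(π * y)) * Real.exp (n * -(2 * π * y)) := by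
    rw [← Real.exp_add]; congr 1; ring
  rw [this]; ring

lemma sech_L' {y : ℝ} (hy : 0 < y) :
    ∫ x in Set.Ioi (0:ℝ), NN x * ((√x)⁻¹ * Real.exp (-(π * y ^ 2 / x))) = sech y := by
  have hpi := Real.pi_pos
  have hm : ∀ n : ℕ, (0:ℝ) < n + 1 / 2 := fun n => by positivity
  have hk := fun n : ℕ => key_int (hm n) hy
  set F : ℕ → ℝ → ℝ := fun n x => (-1 : ℝ) ^ n * (2 * n + 1) * ((√x)⁻¹ * Real.exp (-(π * (n + 1 / 2) ^ 2 * x) - π * y ^ 2 / x)) with hF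
  have hFi : ∀ n, IntegrableOn (F n) (Set.Ioi 0) := fun n => (hk n).1.const_mul _
  have hFint : ∀ n : ℕ, ∫ x in Set.Ioi (0:ℝ), F n x = (-1 : ℝ) ^ n * (2 * Real.exp (-(π * y * (2 * n + 1)))) := by
    intro n
    simp only [hF]
    rw [integral_const_mul, (hk n).2, show -(2 * π * (n + 1 / 2 : ℝ) * y) = -(π * y * (2 * n + 1)) by ring]
    have := hm n
    field_simp
  have hFn : ∀ n : ℕ, ∫ x in Set.Ioi (0:ℝ), ‖F n x‖ = 2 * Real.exp (-(π * y * (2 * n + 1))) := by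
    intro n
    have : ∀ x, ‖F n x‖ = (2 * n + 1) * ((√x)⁻¹ * Real.exp (-(π * (n + 1 / 2) ^ 2 * x) - π * y ^ 2 / x)) := by
      intro x
      simp only [hF]
      rw [norm_mul, norm_mul, norm_pow, norm_neg, norm_one, one_pow, one_mul, Real.norm_eq_abs, Real.norm_eq_abs, abs_of_pos (by positivity), abs_of_nonneg (by positivity)]
    simp_rw [this]
    rw [integral_const_mul, (hk n).2, show -(2 * π * (n + 1 / 2 : ℝ) * y) = -(π * y * (2 * n + 1)) by ring]
    have := hm n
    field_simp
  have hs : Summable fun n => ∫ x in Set.Ioi (0:ℝ), ‖F n x‖ := by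
    simp_rw [hFn]
    have := (sech_hasSum hy).summable.norm
    refine this.congr fun n => ?_
    rw [norm_mul, norm_pow, norm_neg, norm_one, one_pow, one_mul, Real.norm_eq_abs, abs_of_pos (by positivity)]
  have h := hasSum_integral_of_summable_integral_norm hFi hs
  simp_rw [hFint] at h
  rw [← h.unique (sech_hasSum hy)]
  refine setIntegral_congr_fun measurableSet_Ioi fun x hx => ?_
  have h1 := ((hasSum_NN hx).1.mul_right ((√x)⁻¹ * Real.exp (-(π * y ^ 2 / x)))).tsum_eq
  rw [← h1]
  refine tsum_congr fun n => ?_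
  simp only [hF]
  rw [sub_eq_add_neg, Real.exp_add]; ring

lemma sech_L0 {y : ℝ} (hy : 0 < y) :
    ∫ x in Set.Ioi (0:ℝ), NN x * Real.exp (-(π * x * y ^ 2)) = sech y := by
  rw [← sech_L' hy, ← integral_comp_rpow_Ioi _ (neg_ne_zero.2 (one_ne_zero' ℝ))]
  refine setIntegral_congr_fun measurableSet_Ioi fun x hx => ?_
  have hx : 0 < x := hx
  simp only [smul_eq_mul]
  rw [Real.rpow_neg_one, NN_S hx, abs_neg, abs_one, one_mul]
  have : x ^ (-1 - 1 : ℝ) * x ^ (3 / 2 : ℝ) = (√x)⁻¹ := by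
    rw [← Real.rpow_add hx, Real.sqrt_eq_rpow, ← Real.rpow_neg hx.le]; norm_num
  rw [show π * x⁻¹ * y ^ 2 = π * y ^ 2 / x by ring, ← this]; ring

lemma sech_L {y : ℝ} (hy : y ≠ 0) :
    ∫ x in Set.Ioi (0:ℝ), NN x * Real.exp (-(π * x * y ^ 2)) = sech y := by
  rcases hy.lt_or_gt with h | h
  · have := sech_L0 (neg_pos.2 h)
    rwa [neg_sq, sech_neg] at this
  · exact sech_L0 h


lemma NN_int_main : ∃ I0 : ℝ, ∀ (φ : ℝ → ℝ) (K : ℝ), ContinuousOn φ (Set.Ioi 0) →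
    (∀ x : ℝ, 0 < x → |φ x| * x ≤ K * (1 + x)) →
    IntegrableOn (fun x => NN x * φ x) (Set.Ioi 0) ∧ ∫ x in Set.Ioi (0:ℝ), ‖NN x * φ x‖ ≤ K * I0 := by
  obtain ⟨C, hC, hb⟩ := NN_bound
  have hI : IntegrableOn (fun x : ℝ => C * ((1 + x) * Real.exp (-(x / 2)))) (Set.Ioi 0) := by
    have h1 := integrableOn_rpow_mul_exp_neg_mul_rpow (p := 1) (s := 0) (b := 1 / 2) (by norm_num) (by norm_num) (by norm_num)
    have h2 := integrableOn_rpow_mul_exp_neg_mul_rpow (p := 1) (s := 1) (b := 1 / 2) (by norm_num) (by norm_num) (by norm_num)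
    refine IntegrableOn.congr_fun ((h1.add h2).const_mul C) (fun x _ => ?_) measurableSet_Ioi
    simp only [Pi.add_apply, Real.rpow_one, Real.rpow_zero]
    rw [show -(1 / 2) * x = -(x / 2) by ring]; ring
  refine ⟨∫ x in Set.Ioi (0:ℝ), C * ((1 + x) * Real.exp (-(x / 2))), fun φ K hφ hK => ?_⟩
  have hbd : ∀ x ∈ Set.Ioi (0:ℝ), ‖NN x * φ x‖ ≤ K * (C * ((1 + x) * Real.exp (-(x / 2)))) := by
    intro x hx
    have hx : 0 < x := hx
    rw [norm_mul, Real.norm_eq_abs, Real.norm_eq_abs]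
    calc _ ≤ C * (x * Real.exp (-(x / 2))) * |φ x| := by gcongr; exact hb x hx
      _ = C * Real.exp (-(x / 2)) * (|φ x| * x) := by ring
      _ ≤ C * Real.exp (-(x / 2)) * (K * (1 + x)) := mul_le_mul_of_nonneg_left (hK x hx) (by positivity)
      _ = _ := by ring
  have hint : IntegrableOn (fun x => NN x * φ x) (Set.Ioi 0) := by
    refine Integrable.mono' (hI.const_mul K) ((NN_cont.mul hφ).aestronglyMeasurable measurableSet_Ioi) ?_
    exact (ae_restrict_iff' measurableSet_Ioi).2 (ae_of_all _ hbd)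
  refine ⟨hint, ?_⟩
  rw [← integral_const_mul]
  exact setIntegral_mono_on hint.norm (hI.const_mul K) measurableSet_Ioi hbd

lemma summable_inv_one_add : Summable fun k : ℤ => 1 / (1 + (k : ℝ) ^ 2) := by
  have h1 := (Real.summable_one_div_int_pow (p := 2)).2 (by norm_num)
  have h2 : Summable fun k : ℤ => if k = 0 then (1:ℝ) else 0 := (hasSum_ite_eq 0 1).summable
  refine Summable.of_nonneg_of_le (fun k => by positivity) (fun k => ?_) (h1.add h2)
  rcases eq_or_ne k 0 with rfl | hk
  · simp
  · simp only [hk, if_false, add_zero]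
    have : (k : ℝ) ≠ 0 := by exact_mod_cast hk
    have : 0 < (k : ℝ) ^ 2 := by positivity
    gcongr; linarith

lemma exp_le_inv {u : ℝ} (hu : 0 ≤ u) : Real.exp (-u) ≤ 1 / (1 + u) := by
  rw [Real.exp_neg, one_div]
  refine inv_anti₀ (by positivity) ?_
  have := Real.add_one_le_exp u; linarith

lemma summable_gauss_half {t : ℝ} (ht : 0 < t) : Summable fun n : ℤ => Real.exp (-(π * ((n : ℝ) + 1 / 2) ^ 2 * t)) := by
  have hpi := Real.pi_pos
  refine Summable.of_nonneg_of_le (fun k => by positivity) (fun k => ?_) (summable_inv_one_add.mul_left (1 + 4 / (π * t)))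
  refine (exp_le_inv (by positivity)).trans ?_
  rw [mul_one_div, div_le_div_iff₀ (by positivity) (by positivity)]
  have h1 : (0:ℝ) ≤ (3 * k + 1) * (k + 1) := by
    have : (0:ℤ) ≤ (3 * k + 1) * (k + 1) := by
      rcases le_or_gt 0 k with h | h
      · positivity
      · exact mul_nonneg_of_nonpos_of_nonpos (by omega) (by omega)
    exact_mod_cast this
  have h2 : (k:ℝ) ^ 2 / 4 ≤ ((k:ℝ) + 1 / 2) ^ 2 := by nlinarith
  have h3 : (1 + 4 / (π * t)) * (1 + π * ((k:ℝ) ^ 2 / 4) * t) ≤ (1 + 4 / (π * t)) * (1 + π * ((k:ℝ) + 1 / 2) ^ 2 * t) := by gcongr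
  have h4 : (1 + 4 / (π * t)) * (1 + π * ((k:ℝ) ^ 2 / 4) * t) = 1 + k ^ 2 + 4 / (π * t) + π * (k ^ 2 / 4) * t := by
    field_simp; ring
  have : 0 < 4 / (π * t) := by positivity
  have : 0 ≤ π * ((k:ℝ) ^ 2 / 4) * t := by positivity
  linarith

lemma theta_half {s : ℝ} (hs : 0 < s) : ∑' n : ℤ, Real.exp (-(π * ((n : ℝ) + 1 / 2) ^ 2 * s)) = (√s)⁻¹ * ∑' k : ℤ, (-1 : ℝ) ^ k * Real.exp (-(π * k ^ 2 / s)) := by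
  have h := Complex.tsum_exp_neg_quadratic (a := ((s⁻¹ : ℝ) : ℂ)) (by rw [ofReal_re]; positivity) (-I / 2)
  have hsc : (s : ℂ) ≠ 0 := by exact_mod_cast hs.ne'
  have e1 : ∀ n : ℤ, cexp (-π * ((s⁻¹ : ℝ) : ℂ) * n ^ 2 + 2 * π * (-I / 2) * n) = (((-1 : ℝ) ^ n * Real.exp (-(π * n ^ 2 / s)) : ℝ) : ℂ) := by
    intro n
    rw [Complex.exp_add]
    push_cast
    rw [mul_comm]
    congr 1
    · rw [← Complex.exp_pi_mul_I, ← Complex.exp_int_mul]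
      rw [Complex.exp_eq_exp_iff_exists_int]
      exact ⟨-n, by push_cast; ring⟩
    · congr 1; field_simp
  have e2 : ∀ n : ℤ, cexp (-π / ((s⁻¹ : ℝ) : ℂ) * (n + I * (-I / 2)) ^ 2) = ((Real.exp (-(π * ((n : ℝ) + 1 / 2) ^ 2 * s)) : ℝ) : ℂ) := by
    intro n
    push_cast
    rw [show I * (-I / 2) = 1 / 2 by linear_combination (-1 / 2) * I_sq]
    congr 1; field_simp
  have e3 : (1 : ℂ) / ((s⁻¹ : ℝ) : ℂ) ^ (1 / 2 : ℂ) = ((√s : ℝ) : ℂ) := by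
    rw [show (1 / 2 : ℂ) = ((1 / 2 : ℝ) : ℂ) by norm_num, ← ofReal_cpow (by positivity), Real.inv_rpow hs.le, ← Real.sqrt_eq_rpow]
    push_cast; simp
  simp_rw [e1, e2, e3] at h
  rw [← ofReal_tsum, ← ofReal_tsum, ← ofReal_mul] at h
  have h' := ofReal_injective h
  rw [h']
  have := Real.sqrt_pos.2 hs
  rw [inv_mul_cancel_left₀ this.ne']


def SS (t : ℝ) : ℝ := ∑' n : ℤ, Real.exp (-(π * ((n : ℝ) + 1 / 2) ^ 2 * t)) * sech (t * (n + 1 / 2))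

def gk (t k : ℝ) : ℝ := ∫ x in Set.Ioi (0:ℝ), NN x * ((√(x + t))⁻¹ * Real.exp (π * k ^ 2 / (x + t)))

lemma summable_SS {t : ℝ} (ht : 0 < t) : Summable fun n : ℤ => Real.exp (-(π * ((n : ℝ) + 1 / 2) ^ 2 * t)) * sech (t * (n + 1 / 2)) := by
  refine Summable.of_nonneg_of_le (fun n => mul_nonneg (by positivity) (sech_pos _).le) (fun n => ?_) (summable_gauss_half ht)
  exact mul_le_of_le_one_right (by positivity) (sech_le_one _)

lemma half_ne (n : ℤ) : (n : ℝ) + 1 / 2 ≠ 0 := by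
  intro h
  have : (2 * n + 1 : ℝ) = 0 := by linarith
  have : (2 * n + 1 : ℤ) = 0 := by exact_mod_cast this
  omega

lemma sqrt_le_one_add {x : ℝ} (hx : 0 < x) : √x ≤ 1 + x := by
  have := Real.sq_sqrt hx.le
  nlinarith [Real.sqrt_nonneg x, sq_nonneg (√x - 1)]

lemma SS_int {t : ℝ} (ht : 0 < t) :
    SS t = ∫ x in Set.Ioi (0:ℝ), NN x * ((√x)⁻¹ * ∑' n : ℤ, Real.exp (-(π * ((n : ℝ) + 1 / 2) ^ 2 * (t + t ^ 2 / x)))) := by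
  obtain ⟨I0, hI0⟩ := NN_int_main
  have hpi := Real.pi_pos
  set φ : ℤ → ℝ → ℝ := fun n x => (√x)⁻¹ * Real.exp (-(π * ((n : ℝ) + 1 / 2) ^ 2 * (t + t ^ 2 / x))) with hφ
  have hc : ∀ n, ContinuousOn (φ n) (Set.Ioi 0) := by
    intro n
    refine ContinuousOn.mul (ContinuousOn.inv₀ (by fun_prop) fun x hx => (Real.sqrt_pos.2 hx).ne') ?_
    refine Real.continuous_exp.comp_continuousOn (ContinuousOn.neg (continuousOn_const.mul (continuousOn_const.add ?_)))
    exact continuousOn_const.div continuousOn_id fun x hx => ne_of_gt hx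
  have hbd : ∀ n x, 0 < x → |φ n x| * x ≤ Real.exp (-(π * ((n : ℝ) + 1 / 2) ^ 2 * t)) * (1 + x) := by
    intro n x hx
    have hsx := Real.sqrt_pos.2 hx
    rw [abs_of_nonneg (by positivity)]
    calc φ n x * x = Real.exp (-(π * ((n : ℝ) + 1 / 2) ^ 2 * (t + t ^ 2 / x))) * ((√x)⁻¹ * x) := by simp only [hφ]; ring
      _ = Real.exp (-(π * ((n : ℝ) + 1 / 2) ^ 2 * (t + t ^ 2 / x))) * √x := by
        congr 1
        nth_rw 2 [← Real.sq_sqrt hx.le]; field_simp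
      _ ≤ _ := by
        gcongr ?_ * ?_
        · have : 0 < t ^ 2 / x := by positivity
          gcongr; linarith
        · exact sqrt_le_one_add hx
  have hint := fun n => (hI0 (φ n) _ (hc n) (hbd n)).1
  have hnorm : Summable fun n : ℤ => ∫ x in Set.Ioi (0:ℝ), ‖NN x * φ n x‖ := by
    refine Summable.of_nonneg_of_le (fun n => integral_nonneg fun x => norm_nonneg _) (fun n => (hI0 (φ n) _ (hc n) (hbd n)).2) ?_
    exact (summable_gauss_half ht).mul_right I0
  have h := hasSum_integral_of_summable_integral_norm hint hnorm
  have e1 : ∀ n : ℤ, ∫ x in Set.Ioi (0:ℝ), NN x * φ n x = Real.exp (-(π * ((n : ℝ) + 1 / 2) ^ 2 * t)) * sech (t * (n + 1 / 2)) := by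
    intro n
    have hne : t * ((n:ℝ) + 1 / 2) ≠ 0 := mul_ne_zero ht.ne' (half_ne n)
    have hs : sech (t * (n + 1 / 2)) = ∫ x in Set.Ioi (0:ℝ), NN x * ((√x)⁻¹ * Real.exp (-(π * (t * (n + 1 / 2)) ^ 2 / x))) := by
      rcases hne.lt_or_gt with h | h
      · rw [← sech_neg, ← sech_L' (neg_pos.2 h), neg_sq]
      · rw [sech_L' h]
    rw [hs, ← integral_const_mul]
    refine setIntegral_congr_fun measurableSet_Ioi fun x hx => ?_
    simp only [hφ]
    have : Real.exp (-(π * ((n : ℝ) + 1 / 2) ^ 2 * (t + t ^ 2 / x))) = Real.exp (-(π * ((n : ℝ) + 1 / 2) ^ 2 * t)) * Real.exp (-(π * (t * (n + 1 / 2)) ^ 2 / x)) := by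
      rw [← Real.exp_add]; congr 1; ring
    rw [this]; ring
  simp_rw [e1] at h
  rw [SS, h.tsum_eq]
  refine setIntegral_congr_fun measurableSet_Ioi fun x hx => ?_
  simp only [hφ]
  rw [tsum_mul_left, tsum_mul_left]

lemma gk_sum {t : ℝ} (ht : 0 < t) :
    HasSum (fun k : ℤ => (-1 : ℝ) ^ k * (Real.exp (-(π * k ^ 2 / t)) * gk t k)) (√t * SS t) := by
  obtain ⟨I0, hI0⟩ := NN_int_main
  have hpi := Real.pi_gt_three
  set φ : ℤ → ℝ → ℝ := fun k x => (-1 : ℝ) ^ k * ((√(x + t))⁻¹ * Real.exp (-(π * k ^ 2 * (x / (t * (x + t)))))) with hφ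
  have hc : ∀ n, ContinuousOn (φ n) (Set.Ioi 0) := by
    intro n
    have hxt : ∀ x ∈ Set.Ioi (0:ℝ), 0 < x + t := fun x hx => add_pos hx ht
    refine continuousOn_const.mul (ContinuousOn.mul (ContinuousOn.inv₀ (by fun_prop) fun x hx => (Real.sqrt_pos.2 (hxt x hx)).ne') ?_)
    refine Real.continuous_exp.comp_continuousOn (ContinuousOn.neg (continuousOn_const.mul ?_))
    exact continuousOn_id.div (by fun_prop) fun x hx => (mul_pos ht (hxt x hx)).ne'
  have hbd : ∀ k x, 0 < x → |φ k x| * x ≤ ((√t)⁻¹ * (1 + t + t ^ 2) * (1 / (1 + (k:ℝ) ^ 2))) * (1 + x) := by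
    intro k x hx
    have hst := Real.sqrt_pos.2 ht
    simp only [hφ]
    rw [abs_mul, abs_zpow, abs_neg, abs_one, one_zpow, one_mul, abs_of_nonneg (by positivity)]
    set a := x / (t * (x + t)) with ha
    have ha0 : 0 < a := by positivity
    have h1 : (√(x + t))⁻¹ ≤ (√t)⁻¹ := by
      refine inv_anti₀ hst (Real.sqrt_le_sqrt (by linarith))
    have h2 : Real.exp (-(π * k ^ 2 * a)) ≤ (1 + a⁻¹) * (1 / (1 + (k:ℝ) ^ 2)) := by
      refine (exp_le_inv (by positivity)).trans ?_
      rw [mul_one_div, div_le_div_iff₀ (by positivity) (by positivity)]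
      have : (1 + a⁻¹) * (1 + π * k ^ 2 * a) = 1 + a⁻¹ + π * k ^ 2 * a + π * k ^ 2 := by field_simp; ring
      rw [this]
      have : 0 < a⁻¹ := by positivity
      have : 0 ≤ π * k ^ 2 * a := by positivity
      nlinarith [sq_nonneg (k:ℝ)]
    have h3 : (1 + a⁻¹) * x ≤ (1 + t + t ^ 2) * (1 + x) := by
      have : (1 + a⁻¹) * x = x + t * (x + t) := by rw [ha]; field_simp
      rw [this]; nlinarith [mul_pos ht hx, mul_pos (mul_pos ht ht) hx]
    calc _ ≤ (√t)⁻¹ * ((1 + a⁻¹) * (1 / (1 + (k:ℝ) ^ 2))) * x := by gcongr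
      _ = (√t)⁻¹ * (1 / (1 + (k:ℝ) ^ 2)) * ((1 + a⁻¹) * x) := by ring
      _ ≤ (√t)⁻¹ * (1 / (1 + (k:ℝ) ^ 2)) * ((1 + t + t ^ 2) * (1 + x)) := by gcongr
      _ = _ := by ring
  have hint := fun n => (hI0 (φ n) _ (hc n) (hbd n)).1
  have hnorm : Summable fun n : ℤ => ∫ x in Set.Ioi (0:ℝ), ‖NN x * φ n x‖ := by
    refine Summable.of_nonneg_of_le (fun n => integral_nonneg fun x => norm_nonneg _) (fun n => (hI0 (φ n) _ (hc n) (hbd n)).2) ?_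
    exact (summable_inv_one_add.mul_left _).mul_right I0
  have h := hasSum_integral_of_summable_integral_norm hint hnorm
  have e1 : ∀ k : ℤ, ∫ x in Set.Ioi (0:ℝ), NN x * φ k x = (-1 : ℝ) ^ k * (Real.exp (-(π * k ^ 2 / t)) * gk t k) := by
    intro k
    rw [gk, ← integral_const_mul, ← integral_const_mul]
    refine setIntegral_congr_fun measurableSet_Ioi fun x hx => ?_
    have hx : 0 < x := hx
    simp only [hφ]
    have : Real.exp (-(π * k ^ 2 * (x / (t * (x + t))))) = Real.exp (-(π * k ^ 2 / t)) * Real.exp (π * k ^ 2 / (x + t)) := by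
      rw [← Real.exp_add]; congr 1; field_simp; ring
    rw [this]; ring
  simp_rw [e1] at h
  suffices hk : √t * SS t = ∫ x in Set.Ioi (0:ℝ), ∑' k : ℤ, NN x * φ k x by rw [hk]; exact h
  rw [SS_int ht, ← integral_const_mul]
  refine setIntegral_congr_fun measurableSet_Ioi fun x hx => ?_
  have hx : 0 < x := hx
  simp only [hφ]
  rw [theta_half (by positivity), tsum_mul_left]
  have e2 : ∀ k : ℤ, (-1 : ℝ) ^ k * Real.exp (-(π * k ^ 2 / (t + t ^ 2 / x))) * (√(x + t))⁻¹ = (-1 : ℝ) ^ k * ((√(x + t))⁻¹ * Real.exp (-(π * k ^ 2 * (x / (t * (x + t)))))) := by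
    intro k
    rw [show π * (k:ℝ) ^ 2 / (t + t ^ 2 / x) = π * k ^ 2 * (x / (t * (x + t))) by field_simp]; ring
  simp_rw [← e2]
  rw [tsum_mul_right]
  have e3 : √(t + t ^ 2 / x) = √t * √(x + t) / √x := by
    rw [← Real.sqrt_mul ht.le, ← Real.sqrt_div (by positivity)]; congr 1; field_simp
  rw [e3]
  have := Real.sqrt_pos.2 ht
  have := Real.sqrt_pos.2 hx
  have := Real.sqrt_pos.2 (add_pos hx ht)
  field_simp


lemma gauss_shift {A : ℝ} (hA : 0 < A) (k : ℝ) :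
    Integrable (fun u : ℝ => Real.exp (-(π * A * u ^ 2) + 2 * π * k * u)) ∧
    ∫ u : ℝ, Real.exp (-(π * A * u ^ 2) + 2 * π * k * u) = (√A)⁻¹ * Real.exp (π * k ^ 2 / A) := by
  have hpi := Real.pi_pos
  have hAp : 0 < π * A := by positivity
  have e : (fun u : ℝ => Real.exp (-(π * A * u ^ 2) + 2 * π * k * u)) = fun u => Real.exp (π * k ^ 2 / A) * Real.exp (-(π * A) * (u - k / A) ^ 2) := by
    funext u
    rw [← Real.exp_add]; congr 1; field_simp; ring
  rw [e]
  refine ⟨((integrable_exp_neg_mul_sq hAp).comp_sub_right (k / A)).const_mul _, ?_⟩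
  rw [integral_const_mul, integral_sub_right_eq_self (fun u => Real.exp (-(π * A) * u ^ 2)), integral_gaussian, mul_comm]
  congr 1
  rw [show π / (π * A) = A⁻¹ by field_simp, Real.sqrt_inv]

lemma NN_integrable : IntegrableOn NN (Set.Ioi 0) := by
  obtain ⟨I0, hI0⟩ := NN_int_main
  have := (hI0 (fun _ => 1) 1 continuousOn_const (fun x hx => by simp)).1
  simpa using this

lemma gk_eq {t : ℝ} (ht : 0 < t) (k : ℝ) :
    gk t k = ∫ u : ℝ, sech u * Real.exp (-(π * t * u ^ 2) + 2 * π * k * u) := by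
  have hpi := Real.pi_pos
  set f : ℝ → ℝ → ℝ := fun x u => Real.exp (-(π * |x| * u ^ 2)) * (NN x * Real.exp (-(π * t * u ^ 2) + 2 * π * k * u)) with hf
  have hfi : Integrable (Function.uncurry f) ((volume.restrict (Set.Ioi 0)).prod volume) := by
    have h1 := NN_integrable.mul_prod (gauss_shift ht k).1
    refine Integrable.bdd_mul (c := 1) h1 ?_ ?_
    · exact Continuous.aestronglyMeasurable (by fun_prop)
    · refine ae_of_all _ fun z => ?_
      rw [Real.norm_eq_abs, abs_of_pos (Real.exp_pos _), Real.exp_le_one_iff]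
      have : 0 ≤ π * |z.1| * z.2 ^ 2 := by positivity
      linarith
  have h := integral_integral_swap hfi
  have e1 : gk t k = ∫ x in Set.Ioi (0:ℝ), ∫ u : ℝ, f x u := by
    rw [gk]
    refine setIntegral_congr_fun measurableSet_Ioi fun x hx => ?_
    have hx : 0 < x := hx
    rw [← (gauss_shift (add_pos hx ht) k).2, ← integral_const_mul]
    congr 1; funext u
    simp only [hf]
    rw [abs_of_pos hx, mul_left_comm, ← Real.exp_add]
    congr 2; ring
  rw [e1, h]
  refine integral_congr_ae ?_
  have : ∀ᵐ u : ℝ, u ≠ 0 := by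
    simp [ae_iff]
  filter_upwards [this] with u hu
  rw [← sech_L hu, ← integral_mul_const]
  refine setIntegral_congr_fun measurableSet_Ioi fun x hx => ?_
  simp only [hf]
  rw [abs_of_pos hx]; ring

lemma gk_even (t k : ℝ) : gk t (-k) = gk t k := by simp [gk]

lemma sech_gauss_int {t : ℝ} (ht : 0 < t) (k : ℝ) : Integrable fun u : ℝ => sech u * Real.exp (-(π * t * u ^ 2) + 2 * π * k * u) := by
  refine Integrable.bdd_mul (c := 1) (gauss_shift ht k).1 sech_cont.aestronglyMeasurable (ae_of_all _ fun u => ?_)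
  rw [Real.norm_eq_abs, abs_of_pos (sech_pos u)]; exact sech_le_one u

lemma gk_rec {t : ℝ} (ht : 0 < t) (k : ℝ) :
    gk t (k + 1) + gk t k = 2 * (√t)⁻¹ * Real.exp (π * (k + 1 / 2) ^ 2 / t) := by
  rw [gk_eq ht, gk_eq ht, ← integral_add (sech_gauss_int ht _) (sech_gauss_int ht _), mul_assoc 2 (√t)⁻¹, ← (gauss_shift ht (k + 1 / 2)).2, ← integral_const_mul]
  congr 1; funext u
  have h1 : Real.exp (-(π * t * u ^ 2) + 2 * π * (k + 1) * u) = Real.exp (-(π * t * u ^ 2) + 2 * π * (k + 1 / 2) * u) * Real.exp (π * u) := by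
    rw [← Real.exp_add]; congr 1; ring
  have h2 : Real.exp (-(π * t * u ^ 2) + 2 * π * k * u) = Real.exp (-(π * t * u ^ 2) + 2 * π * (k + 1 / 2) * u) * Real.exp (-(π * u)) := by
    rw [← Real.exp_add]; congr 1; ring
  have h3 : sech u * (Real.exp (π * u) + Real.exp (-(π * u))) = 2 := by
    rw [sech, Real.cosh_eq]
    have := Real.exp_pos (π * u)
    have := Real.exp_pos (-(π * u))
    field_simp
  rw [h1, h2]
  linear_combination Real.exp (-(π * t * u ^ 2) + 2 * π * (k + 1 / 2) * u) * h3

lemma gk_sol {t : ℝ} (ht : 0 < t) (k : ℕ) :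
    (-1 : ℝ) ^ k * gk t k = gk t 0 - 2 * (√t)⁻¹ * ∑ j ∈ Finset.range k, (-1 : ℝ) ^ j * Real.exp (π * (j + 1 / 2) ^ 2 / t) := by
  induction k with
  | zero => simp
  | succ k ih =>
    rw [Finset.sum_range_succ, pow_succ]
    have := gk_rec ht k
    push_cast
    linear_combination ih - (-1) ^ k * this


def cE (t : ℝ) (p : ℕ × ℕ) : ℝ := (-1 : ℝ) ^ p.2 * Real.exp (-(π * (((p.1:ℝ) + p.2 + 1) ^ 2 - (p.2 + 1 / 2) ^ 2) / t))

lemma cE_summable {t : ℝ} (ht : 0 < t) : Summable (cE t) := by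
  have hpi := Real.pi_pos
  set r := Real.exp (-(π / t)) with hr
  have hr1 : r < 1 := by
    rw [hr, Real.exp_lt_one_iff]; have : 0 < π / t := by positivity
    linarith
  have hg := summable_geometric_of_lt_one (Real.exp_pos (-(π / t))).le hr1
  have h2 := hg.mul_of_nonneg hg (fun n => by positivity) (fun n => by positivity)
  refine Summable.of_norm_bounded h2 fun p => ?_
  rw [cE, norm_mul, norm_pow, norm_neg, norm_one, one_pow, one_mul, Real.norm_eq_abs, abs_of_pos (Real.exp_pos _), ← Real.exp_nat_mul, ← Real.exp_nat_mul, ← Real.exp_add, Real.exp_le_exp]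
  have : (p.1:ℝ) + p.2 ≤ ((p.1:ℝ) + p.2 + 1) ^ 2 - (p.2 + 1 / 2) ^ 2 := by
    have h1 : (0:ℝ) ≤ p.1 := Nat.cast_nonneg _
    have h2 : (0:ℝ) ≤ p.2 := Nat.cast_nonneg _
    nlinarith [mul_nonneg h1 h2]
  have h3 := mul_le_mul_of_nonneg_left this (show 0 ≤ π / t by positivity)
  have h4 : π * (((p.1:ℝ) + p.2 + 1) ^ 2 - (p.2 + 1 / 2) ^ 2) / t = π / t * (((p.1:ℝ) + p.2 + 1) ^ 2 - (p.2 + 1 / 2) ^ 2) := by ring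
  rw [h4]; linarith

lemma cE_SS {t : ℝ} (ht : 0 < t) : ∑' p, cE t p = SS t⁻¹ / 4 := by
  have hti : 0 < t⁻¹ := inv_pos.2 ht
  have hl : ∀ n : ℕ, HasSum (fun l => cE t (n, l)) (Real.exp (-(π * ((n : ℝ) + 1 / 2) ^ 2 * t⁻¹)) * sech (t⁻¹ * (n + 1 / 2)) / 2) := by
    intro n
    have h := ((sech_hasSum (y := t⁻¹ * (n + 1 / 2)) (by positivity)).mul_left (Real.exp (-(π * ((n : ℝ) + 1 / 2) ^ 2 * t⁻¹)))).div_const 2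
    refine h.congr_fun fun l => ?_
    simp only [cE]
    have : Real.exp (-(π * (((n:ℝ) + l + 1) ^ 2 - (l + 1 / 2) ^ 2) / t)) = Real.exp (-(π * ((n : ℝ) + 1 / 2) ^ 2 * t⁻¹)) * Real.exp (-(π * (t⁻¹ * (n + 1 / 2)) * (2 * l + 1))) := by
      rw [← Real.exp_add]; congr 1; field_simp; ring
    rw [this]; ring
  have h1 := (cE_summable ht).hasSum.prod_fiberwise hl
  have h2 := h1.mul_left 2
  have h3 : HasSum (fun n : ℕ => Real.exp (-(π * (((n:ℤ) : ℝ) + 1 / 2) ^ 2 * t⁻¹)) * sech (t⁻¹ * (((n:ℤ):ℝ) + 1 / 2))) (2 * ∑' p, cE t p) := by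
    refine h2.congr_fun fun n => ?_
    push_cast; ring
  have h4 : HasSum (fun n : ℕ => Real.exp (-(π * (((-((n:ℤ) + 1) : ℤ) : ℝ) + 1 / 2) ^ 2 * t⁻¹)) * sech (t⁻¹ * (((-((n:ℤ) + 1):ℤ):ℝ) + 1 / 2))) (2 * ∑' p, cE t p) := by
    refine h3.congr_fun fun n => ?_
    push_cast
    rw [← sech_neg, show (-((n:ℝ) + 1) + 1 / 2) ^ 2 = ((n:ℝ) + 1 / 2) ^ 2 by ring, show -(t⁻¹ * (-((n:ℝ) + 1) + 1 / 2)) = t⁻¹ * (n + 1 / 2) by ring]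
  have h5 := h3.of_nat_of_neg_add_one (f := fun n : ℤ => Real.exp (-(π * ((n : ℝ) + 1 / 2) ^ 2 * t⁻¹)) * sech (t⁻¹ * (n + 1 / 2))) h4
  rw [SS, h5.tsum_eq]; ring

lemma cE_anti {t : ℝ} (ht : 0 < t) : HasSum (fun m : ℕ => Real.exp (-(π * ((m:ℝ) + 1) ^ 2 / t)) * ∑ j ∈ Finset.range (m + 1), (-1 : ℝ) ^ j * Real.exp (π * (j + 1 / 2) ^ 2 / t)) (SS t⁻¹ / 4) := by
  rw [← cE_SS ht]
  have h := ((Finset.HasAntidiagonal.sigmaAntidiagonalEquivProd (A := ℕ)).hasSum_iff.2 (cE_summable ht).hasSum).sigma (fun m => Finset.hasSum (Finset.HasAntidiagonal.antidiagonal m) (cE t))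
  refine h.congr_fun fun m => ?_
  rw [← Finset.Nat.sum_antidiagonal_swap, Finset.Nat.sum_antidiagonal_eq_sum_range_succ_mk, Finset.mul_sum]
  refine Finset.sum_congr rfl fun j hj => ?_
  have hj : j ≤ m := by simpa [Nat.lt_succ_iff] using hj
  simp only [cE, Prod.swap]
  rw [mul_left_comm, ← Real.exp_add]
  congr 2
  push_cast [hj]
  ring

lemma summable_gauss_int {t : ℝ} (ht : 0 < t) : Summable fun n : ℤ => Real.exp (-(π * (n : ℝ) ^ 2 / t)) := by
  have hpi := Real.pi_pos
  refine Summable.of_nonneg_of_le (fun k => by positivity) (fun k => ?_) (summable_inv_one_add.mul_left (1 + t / π))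
  refine (exp_le_inv (by positivity)).trans ?_
  rw [mul_one_div, div_le_div_iff₀ (by positivity) (by positivity)]
  have h4 : (1 + t / π) * (1 + π * (k:ℝ) ^ 2 / t) = 1 + k ^ 2 + t / π + π * k ^ 2 / t := by
    field_simp; ring
  have : 0 < t / π := by positivity
  have : 0 ≤ π * (k:ℝ) ^ 2 / t := by positivity
  linarith

lemma SS_S {t : ℝ} (ht : 0 < t) :
    √t * SS t = gk t 0 * (∑' k : ℤ, Real.exp (-(π * (k : ℝ) ^ 2 / t))) - (√t)⁻¹ * SS t⁻¹ := by
  have h := (gk_sum ht).sub ((summable_gauss_int ht).hasSum.mul_left (gk t 0))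
  have h2 := h.nat_add_neg
  simp only [Int.cast_zero, neg_zero, zpow_zero] at h2
  have e0 : (1 * (Real.exp (-(π * (0:ℝ) ^ 2 / t)) * gk t 0) - gk t 0 * Real.exp (-(π * (0:ℝ) ^ 2 / t))) = 0 := by ring
  rw [e0, add_zero] at h2
  have h3 := (hasSum_nat_add_iff' 1).2 h2
  have h4 := ((cE_anti ht).mul_left (2 * (-(2 * (√t)⁻¹))))
  have h5 := h4.unique (h3.congr_fun fun m => ?_)
  · simp only [Finset.range_one, Finset.sum_singleton] at h5
    have : (0:ℝ) = 0 := rfl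
    simp at h5
    linear_combination -h5
  · have hs := gk_sol ht (m + 1)
    have e1 : ((-1:ℝ)) ^ ((m + 1 : ℕ) : ℤ) = (-1) ^ (m + 1) := zpow_natCast _ _
    have e2 : ((-1:ℝ)) ^ (-((m + 1 : ℕ) : ℤ)) = (-1) ^ (m + 1) := by
      rw [zpow_neg, e1]
      rcases neg_one_pow_eq_or ℝ (m + 1) with h | h <;> rw [h] <;> norm_num
    rw [e1, e2]
    push_cast at hs ⊢
    rw [gk_even, neg_sq]
    linear_combination -2 * Real.exp (-(π * ((m:ℝ) + 1) ^ 2 / t)) * hs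


lemma holo_int {f : ℂ → ℝ → ℂ} {z0 : ℂ} {r : ℝ} (hr : 0 < r) {bound : ℝ → ℝ}
    (hdiff : ∀ s ∈ Set.Ioi (0:ℝ), DifferentiableOn ℂ (fun z => f z s) (Metric.ball z0 r))
    (hmeas : ∀ z ∈ Metric.ball z0 r, AEStronglyMeasurable (f z) (volume.restrict (Set.Ioi 0)))
    (hbd : ∀ s ∈ Set.Ioi (0:ℝ), ∀ z ∈ Metric.ball z0 r, ‖f z s‖ ≤ bound s)
    (hint : IntegrableOn bound (Set.Ioi 0)) :
    DifferentiableAt ℂ (fun z => ∫ s in Set.Ioi (0:ℝ), f z s) z0 := by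
  have hz0 : z0 ∈ Metric.ball z0 r := Metric.mem_ball_self hr
  have hd : ∀ s ∈ Set.Ioi (0:ℝ), ∀ z ∈ Metric.ball z0 r, HasDerivAt (fun z => f z s) (deriv (fun z => f z s) z) z := fun s hs z hz =>
    ((hdiff s hs).differentiableAt (Metric.isOpen_ball.mem_nhds hz)).hasDerivAt
  have hsub : ∀ z ∈ Metric.ball z0 (r / 2), Metric.closedBall z (r / 2) ⊆ Metric.ball z0 r := by
    intro z hz w hw
    rw [Metric.mem_ball] at hz ⊢
    rw [Metric.mem_closedBall] at hw
    linarith [dist_triangle w z z0]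
  refine (hasDerivAt_integral_of_dominated_loc_of_deriv_le (F := f) (F' := fun z s => deriv (fun z => f z s) z) (bound := fun s => bound s / (r / 2))
    (Metric.ball_mem_nhds z0 (half_pos hr)) ?_ ?_ ?_ ?_ (hint.div_const _) ?_).2.differentiableAt
  · filter_upwards [Metric.ball_mem_nhds z0 hr] with z hz using hmeas z hz
  · exact hint.mono' (hmeas z0 hz0) ((ae_restrict_iff' measurableSet_Ioi).2 (ae_of_all _ fun s hs => hbd s hs z0 hz0))
  · set u : ℕ → ℂ := fun n => z0 + ((r / (n + 2) : ℝ) : ℂ) with hu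
    have hup : ∀ n : ℕ, 0 < r / ((n:ℝ) + 2) := fun n => by positivity
    have hun : ∀ n, u n ∈ Metric.ball z0 r := by
      intro n
      simp only [hu, Metric.mem_ball, dist_self_add_left, norm_real, Real.norm_eq_abs]
      rw [abs_of_pos (hup n)]
      have : (0:ℝ) ≤ n := Nat.cast_nonneg n
      rw [div_lt_iff₀ (by positivity)]; nlinarith
    have hut : Tendsto u atTop (𝓝[≠] z0) := by
      refine tendsto_nhdsWithin_iff.2 ⟨?_, Eventually.of_forall fun n => ?_⟩
      · have h1 : Tendsto (fun n : ℕ => r / ((n:ℝ) + 2)) atTop (𝓝 0) :=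
          Tendsto.const_div_atTop (tendsto_atTop_add_const_right _ _ tendsto_natCast_atTop_atTop) r
        have h2 : Tendsto (fun n : ℕ => ((r / ((n:ℝ) + 2) : ℝ) : ℂ)) atTop (𝓝 ((0:ℝ):ℂ)) := (continuous_ofReal.tendsto 0).comp h1
        have h3 := h2.const_add z0
        rw [ofReal_zero, add_zero] at h3
        exact h3
      · simp only [hu, Set.mem_compl_iff, Set.mem_singleton_iff, add_eq_left]
        exact_mod_cast (hup n).ne'
    refine aestronglyMeasurable_of_tendsto_ae atTop (f := fun n s => slope (fun z => f z s) z0 (u n)) (fun n => ?_) ?_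
    · simp only [slope_def_field]
      simp only [div_eq_mul_inv]
      exact ((hmeas _ (hun n)).sub (hmeas _ hz0)).mul_const _
    · refine (ae_restrict_iff' measurableSet_Ioi).2 (ae_of_all _ fun s hs => ?_)
      exact (hasDerivAt_iff_tendsto_slope.1 (hd s hs z0 hz0)).comp hut
  · refine (ae_restrict_iff' measurableSet_Ioi).2 (ae_of_all _ fun s hs z hz => ?_)
    refine Complex.norm_deriv_le_of_forall_mem_sphere_norm_le (half_pos hr) ?_ fun w hw => hbd s hs w (hsub z hz (Metric.sphere_subset_closedBall hw))
    refine ((hdiff s hs).mono ?_).diffContOnCl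
    rw [closure_ball _ (half_pos hr).ne']; exact hsub z hz
  · refine (ae_restrict_iff' measurableSet_Ioi).2 (ae_of_all _ fun s hs z hz => hd s hs z (Metric.ball_subset_ball (by linarith) hz))

def Ei (a τ : ℂ) : ℂ := ∫ s in Set.Ioi (0:ℝ), etaDedekind (a + I * s) ^ 3 * (-I * ((a + I * s) + τ)) ^ (-(1 / 2) : ℂ) * I

lemma ei_slit {a τ : ℂ} {s : ℝ} (ha : 0 < a.im) (hτ : 0 < τ.im) (hs : 0 ≤ s) : (-I * ((a + I * s) + τ)).re = a.im + s + τ.im ∧ -I * ((a + I * s) + τ) ∈ slitPlane := by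
  have h : (-I * ((a + I * s) + τ)).re = a.im + s + τ.im := by simp
  exact ⟨h, Or.inl (by rw [h]; positivity)⟩

lemma Ei_diff {α β : ℂ → ℂ} {U : Set ℂ} (hU : IsOpen U) (hα : DifferentiableOn ℂ α U) (hβ : DifferentiableOn ℂ β U)
    (ha : ∀ z ∈ U, 0 < (α z).im) (hb : ∀ z ∈ U, 0 < (β z).im) : DifferentiableOn ℂ (fun z => Ei (α z) (β z)) U := by
  intro z0 hz0
  refine DifferentiableAt.differentiableWithinAt ?_
  set δ := (α z0).im / 2 with hδd
  have hδ : 0 < δ := half_pos (ha z0 hz0)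
  obtain ⟨C, hC, hCb⟩ := eta3_bound hδ
  have hcα : ContinuousAt α z0 := (hα.differentiableAt (hU.mem_nhds hz0)).continuousAt
  have hnh : {z | z ∈ U ∧ δ < (α z).im} ∈ 𝓝 z0 := by
    refine Filter.inter_mem (hU.mem_nhds hz0) ?_
    exact (continuous_im.continuousAt.comp hcα).eventually (lt_mem_nhds (half_lt_self (ha z0 hz0)))
  obtain ⟨r, hr, hrs⟩ := Metric.mem_nhds_iff.1 hnh
  have him : ∀ (z : ℂ) (s : ℝ), (α z + I * s).im = (α z).im + s := fun z s => by simp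
  refine holo_int hr (bound := fun s => C * δ ^ (-(1/2) : ℝ) * Real.exp (-(π / 4) * s)) ?_ ?_ ?_ ?_
  · intro s hs z hz
    have hs : 0 < s := hs
    obtain ⟨hzU, hzδ⟩ := hrs hz
    have d1 : DifferentiableAt ℂ α z := hα.differentiableAt (hU.mem_nhds hzU)
    have d2 : DifferentiableAt ℂ β z := hβ.differentiableAt (hU.mem_nhds hzU)
    have d3 : DifferentiableAt ℂ (fun z => etaDedekind (α z + I * s) ^ 3) z :=
      DifferentiableAt.comp z (g := fun w => etaDedekind w ^ 3) (eta3_diffAt (by rw [him]; have := ha z hzU; positivity)) (d1.add_const _)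
    have d4 : DifferentiableAt ℂ (fun z => (-I * ((α z + I * s) + β z)) ^ (-(1 / 2) : ℂ)) z :=
      DifferentiableAt.cpow (by fun_prop) (by fun_prop) (ei_slit (ha z hzU) (hb z hzU) hs.le).2
    exact ((d3.mul d4).mul_const I).differentiableWithinAt
  · intro z hz
    obtain ⟨hzU, hzδ⟩ := hrs hz
    refine ContinuousOn.aestronglyMeasurable (fun s hs => ?_) measurableSet_Ioi
    have hs : 0 < s := hs
    have c1 : ContinuousAt (fun s : ℝ => etaDedekind (α z + I * s) ^ 3) s :=
      ContinuousAt.comp (f := fun s : ℝ => α z + I * s) (g := fun w => etaDedekind w ^ 3) (eta3_diffAt (by rw [him]; have := ha z hzU; positivity)).continuousAt (by fun_prop)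
    have c2 : ContinuousAt (fun s : ℝ => (-I * ((α z + I * s) + β z)) ^ (-(1 / 2) : ℂ)) s :=
      ContinuousAt.cpow (by fun_prop) continuousAt_const (ei_slit (ha z hzU) (hb z hzU) hs.le).2
    exact ((c1.mul c2).mul continuousAt_const).continuousWithinAt
  · intro s hs z hz
    have hs : 0 < s := hs
    obtain ⟨hzU, hzδ⟩ := hrs hz
    have hzδ : δ < (α z).im := hzδ
    have hpi := Real.pi_pos
    have hbz := hb z hzU
    rw [norm_mul, norm_mul, norm_I, mul_one]
    have n1 : ‖etaDedekind (α z + I * s) ^ 3‖ ≤ C * Real.exp (-(π / 4) * s) := by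
      refine (hCb _ (by rw [him]; linarith)).trans ?_
      gcongr
      rw [him]; nlinarith [mul_pos hpi (hδ.trans hzδ)]
    have n2 : ‖(-I * ((α z + I * s) + β z)) ^ (-(1 / 2) : ℂ)‖ ≤ δ ^ (-(1/2) : ℝ) := by
      rw [show (-(1 / 2) : ℂ) = ((-(1/2) : ℝ) : ℂ) by push_cast; ring, norm_cpow_real]
      refine Real.rpow_le_rpow_of_nonpos hδ ?_ (by norm_num)
      have h1 := (ei_slit (ha z hzU) hbz hs.le).1
      have h2 := re_le_norm (-I * ((α z + I * s) + β z))
      rw [h1] at h2; linarith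
    calc _ ≤ (C * Real.exp (-(π / 4) * s)) * δ ^ (-(1/2) : ℝ) := by gcongr
      _ = _ := by ring
  · exact (integrableOn_exp_mul_Ioi (by have := Real.pi_pos; linarith) 0).const_mul _

def UH : Set ℂ := {z : ℂ | 0 < z.im}
lemma UH_open : IsOpen UH := isOpen_lt continuous_const continuous_im
lemma UH_conn : IsPreconnected UH := (convex_halfSpace_im_gt 0).isPreconnected

lemma ident_thm {f : ℂ → ℂ} (hf : DifferentiableOn ℂ f UH) (h0 : ∀ t : ℝ, 0 < t → f (I * t) = 0) {z : ℂ} (hz : 0 < z.im) : f z = 0 := by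
  have hI : I ∈ UH := by simp [UH]
  have h1 : ∃ᶠ z in 𝓝[≠] I, f z = 0 := by
    have ht : Tendsto (fun t : ℝ => I * (t:ℂ)) (𝓝[≠] 1) (𝓝[≠] I) := by
      refine tendsto_nhdsWithin_iff.2 ⟨?_, ?_⟩
      · have : ContinuousAt (fun t : ℝ => I * (t:ℂ)) 1 := by fun_prop
        have h := this.tendsto
        simp only [ofReal_one, mul_one] at h
        exact h.mono_left nhdsWithin_le_nhds
      · filter_upwards [self_mem_nhdsWithin] with t ht
        intro h
        apply ht
        have : I * (t:ℂ) = I * 1 := by simpa using h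
        have := mul_left_cancel₀ I_ne_zero this
        exact_mod_cast this
    refine ht.frequently (Eventually.frequently ?_)
    filter_upwards [nhdsWithin_le_nhds (lt_mem_nhds (zero_lt_one' ℝ))] with t ht using h0 t ht
  exact (hf.analyticOnNhd UH_open).eqOn_zero_of_preconnected_of_frequently_eq_zero UH_conn hI h1 hz


lemma FF_axis {t : ℝ} (ht : 0 < t) : FF (I * t) = ((SS t / 2 : ℝ) : ℂ) := by
  rw [FF, SS, ← (Equiv.addRight (1 : ℤ)).tsum_eq, ← tsum_div_const, ofReal_tsum]
  refine tsum_congr fun n => ?_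
  simp only [Equiv.coe_addRight, qp]
  set a : ℝ := t * (n + 1 / 2) with ha
  have h1 : (2 * (π:ℂ) * I * (I * t) * (((n + 1 : ℤ) : ℂ) ^ 2 / 2 - 1 / 8)) = ((-(π * ((n:ℝ) + 1 / 2) ^ 2 * t) + -(π * a) : ℝ) : ℂ) := by
    rw [ha]; push_cast; linear_combination (π:ℂ) * t * ((n + 1) ^ 2 - 1 / 4) * I_sq
  have h2 : (2 * (π:ℂ) * I * (I * t) * (((n + 1 : ℤ) : ℂ) - 1 / 2)) = ((-(π * a) + -(π * a) : ℝ) : ℂ) := by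
    rw [ha]; push_cast; linear_combination (π:ℂ) * t * (2 * n + 1) * I_sq
  rw [h1, h2, ← ofReal_exp, ← ofReal_exp]
  norm_cast
  rw [Real.exp_add, Real.exp_add (-(π * a)), sech, Real.cosh_eq]
  have h3 : Real.exp (π * a) * Real.exp (-(π * a)) = 1 := by rw [← Real.exp_add]; simp
  have h4 := Real.exp_pos (π * a)
  have h5 := Real.exp_pos (-(π * a))
  generalize Real.exp (π * a) = u at *
  generalize Real.exp (-(π * a)) = v at *
  rw [div_eq_div_iff (by positivity) (by norm_num)]
  field_simp
  linear_combination h3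

lemma theta3_axis {t : ℝ} (ht : 0 < t) : theta3 (I * (t⁻¹ : ℝ)) = ((∑' k : ℤ, Real.exp (-(π * (k : ℝ) ^ 2 / t)) : ℝ) : ℂ) := by
  rw [theta3, ofReal_tsum]
  refine tsum_congr fun n => ?_
  rw [qp, ofReal_exp]; congr 1; push_cast
  linear_combination (π:ℂ) * (t:ℂ)⁻¹ * n ^ 2 * I_sq

def h3 (τ : ℂ) : ℂ := FF τ / theta3 τ

def JJ (t y : ℝ) : ℝ := ∫ x in Set.Ioi y, NN x * (√(x + t))⁻¹

lemma JJ_int {t : ℝ} (ht : 0 < t) : IntegrableOn (fun x => NN x * (√(x + t))⁻¹) (Set.Ioi 0) := by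
  obtain ⟨I0, hI⟩ := NN_int_main
  refine (hI (fun x => (√(x + t))⁻¹) (√t)⁻¹ ?_ ?_).1
  · refine ContinuousOn.inv₀ (by fun_prop) fun x hx => ?_
    have : (0:ℝ) < x := hx
    positivity
  · intro x hx
    have h1 : √t ≤ √(x + t) := Real.sqrt_le_sqrt (by linarith)
    have h2 : (√(x + t))⁻¹ ≤ (√t)⁻¹ := inv_anti₀ (by positivity) h1
    rw [abs_of_nonneg (by positivity)]
    have : (0:ℝ) ≤ (√t)⁻¹ := by positivity
    nlinarith

lemma JJ_sub {t y : ℝ} (ht : 0 < t) (hy : 0 < y) : ∫ x in Set.Ioo 0 y, NN x * (√(x + t))⁻¹ = (√t)⁻¹ * JJ t⁻¹ y⁻¹ := by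
  have him : (fun x : ℝ => x⁻¹) '' Set.Ioi y⁻¹ = Set.Ioo 0 y := by
    ext x; constructor
    · rintro ⟨z, hz, rfl⟩
      have hz0 : 0 < z := lt_trans (by positivity) hz
      exact ⟨by positivity, inv_lt_of_inv_lt₀ hy hz⟩
    · rintro ⟨h1, h2⟩
      exact ⟨x⁻¹, by simpa using inv_strictAnti₀ h1 h2, by simp⟩
  rw [← him, integral_image_eq_integral_abs_deriv_smul measurableSet_Ioi (f' := fun x => -(x ^ 2)⁻¹)
    (fun x hx => (hasDerivAt_inv (lt_trans (inv_pos.2 hy) hx).ne').hasDerivWithinAt) inv_injective.injOn, JJ, ← integral_const_mul]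
  refine setIntegral_congr_fun measurableSet_Ioi fun x hx => ?_
  have hx0 : 0 < x := lt_trans (inv_pos.2 hy) hx
  simp only [smul_eq_mul]
  rw [abs_neg, abs_of_pos (by positivity), NN_S hx0]
  have e1 : x⁻¹ + t = t * (x + t⁻¹) / x := by
    field_simp; ring
  have e2 : x ^ (3 / 2 : ℝ) = x * √x := by
    rw [show (3/2 : ℝ) = 1 + 1 / 2 by norm_num, Real.rpow_add hx0, Real.rpow_one, Real.sqrt_eq_rpow]
  rw [e1, e2, Real.sqrt_div (by positivity), Real.sqrt_mul ht.le]
  have := Real.sq_sqrt hx0.le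
  have hs : 0 < √x := by positivity
  have hs2 : 0 < √(x + t⁻¹) := by positivity
  have hs3 : 0 < √t := by positivity
  field_simp
  rw [this]

lemma JJ_S {t y : ℝ} (ht : 0 < t) (hy : 0 < y) : gk t 0 = (√t)⁻¹ * JJ t⁻¹ y⁻¹ + JJ t y := by
  have h0 : gk t 0 = ∫ x in Set.Ioi 0, NN x * (√(x + t))⁻¹ := by
    rw [gk]; simp
  rw [h0, ← JJ_sub ht hy, JJ, ← integral_Ioc_eq_integral_Ioo, ← setIntegral_union (Set.Ioc_disjoint_Ioi le_rfl) measurableSet_Ioi, Set.Ioc_union_Ioi_eq_Ioi hy.le]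
  · exact (JJ_int ht).mono_set Set.Ioc_subset_Ioi_self
  · exact (JJ_int ht).mono_set (Set.Ioi_subset_Ioi hy.le)

lemma Ei_axis {t y : ℝ} (ht : 0 < t) (hy : 0 < y) : Ei (I * y) (I * t) = I * (JJ t y : ℝ) := by
  have h1 : JJ t y = ∫ s in Set.Ioi (0:ℝ), NN (s + y) * (√((s + y) + t))⁻¹ := by
    have h := (measurePreserving_add_right volume y).setIntegral_preimage_emb (measurableEmbedding_addRight y) (fun x => NN x * (√(x + t))⁻¹) (Set.Ioi y)
    rw [JJ, ← h]; simp
  rw [Ei, h1, ← integral_complex_ofReal, ← integral_const_mul]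
  refine setIntegral_congr_fun measurableSet_Ioi fun s hs => ?_
  have hs0 : (0:ℝ) < s := hs
  have e1 : I * (y:ℂ) + I * s = I * ((s + y : ℝ) : ℂ) := by push_cast; ring
  have e2 : -I * (I * ((s + y : ℝ) : ℂ) + I * t) = ((s + y + t : ℝ) : ℂ) := by
    push_cast; linear_combination -((s:ℂ) + y + t) * I_sq
  beta_reduce
  rw [e1, e2, ← (hasSum_NN (by positivity : 0 < s + y)).2]
  have e3 : (((s + y + t : ℝ) : ℂ)) ^ (-(1 / 2) : ℂ) = (((√(s + y + t))⁻¹ : ℝ) : ℂ) := by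
    rw [Real.sqrt_eq_rpow, ← Real.rpow_neg (by positivity), ofReal_cpow (by positivity)]; push_cast; rfl
  rw [e3]; push_cast; ring

def KK (τ a : ℂ) : ℂ := h3 τ + I / 2 * Ei a τ

lemma sqrt_axis {t : ℝ} (ht : 0 < t) : (-I * (I * t)) ^ (1 / 2 : ℂ) = ((√t : ℝ) : ℂ) := by
  rw [show -I * (I * t) = (t:ℂ) by linear_combination -(t:ℂ) * I_sq, Real.sqrt_eq_rpow, ofReal_cpow ht.le]; push_cast; rfl

lemma neg_inv_axis {t : ℝ} (ht : 0 < t) : -1 / (I * t) = I * (t⁻¹ : ℝ) := by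
  have : (t:ℂ) ≠ 0 := by exact_mod_cast ht.ne'
  push_cast
  rw [div_eq_iff (mul_ne_zero I_ne_zero this)]
  field_simp; rw [I_sq]

lemma h3_axis {t : ℝ} (ht : 0 < t) : h3 (I * t) = gk t 0 / 2 - ((√t : ℝ) : ℂ)⁻¹ * h3 (I * (t⁻¹ : ℝ)) := by
  have hi : 0 < t⁻¹ := inv_pos.2 ht
  have hs := SS_S ht
  have hT := theta3_S (τ := I * t) (by simpa using ht)
  rw [sqrt_axis ht, neg_inv_axis ht] at hT
  have hne := theta3_ne (τ := I * t) (by simpa using ht)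
  have hne2 := theta3_ne (τ := I * (t⁻¹ : ℝ)) (by rw [Ix_im]; exact hi)
  rw [h3, h3, FF_axis ht, FF_axis hi]
  have h2 : ((√t : ℝ) : ℂ) * SS t = gk t 0 * theta3 (I * (t⁻¹ : ℝ)) - ((√t : ℝ) : ℂ)⁻¹ * SS t⁻¹ := by
    rw [theta3_axis ht]; exact_mod_cast hs
  have hsq : ((√t : ℝ) : ℂ) ≠ 0 := by
    have : 0 < √t := by positivity
    exact_mod_cast this.ne'
  generalize ((√t : ℝ) : ℂ) = r at *
  generalize theta3 (I * (t⁻¹ : ℝ)) = A at *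
  subst hT
  push_cast
  field_simp
  field_simp at h2
  linear_combination h2

lemma KK_axis {t y : ℝ} (ht : 0 < t) (hy : 0 < y) : KK (-1 / (I * t)) (-1 / (I * y)) = -(-I * (I * t)) ^ (1 / 2 : ℂ) * KK (I * t) (I * y) := by
  have hi : 0 < t⁻¹ := inv_pos.2 ht
  have hj : 0 < y⁻¹ := inv_pos.2 hy
  rw [sqrt_axis ht, neg_inv_axis ht, neg_inv_axis hy, KK, KK, Ei_axis ht hy, Ei_axis hi hj, h3_axis ht, JJ_S ht hy]
  have hsq : ((√t : ℝ) : ℂ) ≠ 0 := by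
    have : 0 < √t := by positivity
    exact_mod_cast this.ne'
  push_cast
  generalize ((√t : ℝ) : ℂ) = r at *
  field_simp
  rw [I_sq]; ring


lemma theta3_diff : DifferentiableOn ℂ theta3 UH := by
  intro z hz
  rw [show theta3 = jacobiTheta₂ 0 from funext theta3_jt]
  exact (differentiableAt_jacobiTheta₂_snd 0 hz).differentiableWithinAt

lemma nm_norm (τ : ℂ) : ‖nm τ‖ = Real.exp (-(π * τ.im)) := by
  rw [nm, norm_exp]; congr 1; simp

lemma B3_diff : DifferentiableOn ℂ B3 UH := by
  intro z hz
  have hz : 0 < z.im := hz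
  refine DifferentiableAt.differentiableWithinAt ?_
  set δ : ℝ := z.im / 2 with hδ
  have hδ0 : 0 < δ := by positivity
  set U : Set ℂ := {w | δ < w.im} with hU
  have hUo : IsOpen U := isOpen_lt continuous_const continuous_im
  have hzU : z ∈ U := by simp only [hU, Set.mem_setOf_eq, hδ]; linarith
  have hpi := Real.pi_pos
  set p : ℝ := Real.exp (-(π * δ)) with hp
  have hp1 : p < 1 := by rw [hp, Real.exp_lt_one_iff]; nlinarith [mul_pos hpi hδ0]
  have hwp : ∀ w ∈ U, ‖nm w‖ ≤ p := fun w hw => by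
    rw [nm_norm, hp]
    have : δ < w.im := hw
    gcongr
  have hs : Summable fun n : ℤ => Real.exp (-(π * (n : ℝ) ^ 2 / δ⁻¹)) * (1 - p)⁻¹ :=
    (summable_gauss_int (inv_pos.2 hδ0)).mul_right _
  refine (differentiableOn_tsum_of_summable_norm (F := fun (n : ℤ) τ => nm τ ^ (n ^ 2) * (1 + nm τ ^ (2 * n - 1))⁻¹) hs ?_ hUo ?_).differentiableAt (hUo.mem_nhds hzU)
  · intro n w hw
    have hw0 : 0 < w.im := lt_trans hδ0 hw
    refine DifferentiableAt.differentiableWithinAt ?_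
    have h1p := one_sub_ne (nm_ne w) (nm_lt hw0) (m := 2 * n - 1) (by omega) (w := -nm w ^ (2 * n - 1)) (by rw [norm_neg, norm_zpow])
    rw [sub_neg_eq_add] at h1p
    have hd : ∀ m : ℤ, DifferentiableAt ℂ (fun τ => nm τ ^ m) w := fun m => by
      simp only [nm_zpow]; fun_prop
    exact (hd _).mul (((hd _).const_add 1).inv h1p)
  · intro n w hw
    have hw0 : 0 < w.im := lt_trans hδ0 hw
    have h1 := inv_one_sub_le (nm_ne w) (nm_lt hw0) (m := 2 * n - 1) (by omega) (w := -nm w ^ (2 * n - 1)) (by rw [norm_neg, norm_zpow])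
    rw [sub_neg_eq_add] at h1
    have h2 := hwp w hw
    have h3 : (1 - ‖nm w‖)⁻¹ ≤ (1 - p)⁻¹ := inv_anti₀ (by linarith) (by linarith)
    have h4 : ‖nm w ^ (n ^ 2)‖ ≤ Real.exp (-(π * (n : ℝ) ^ 2 / δ⁻¹)) := by
      have hw1 : δ < w.im := hw
      rw [nm_zpow, norm_exp, div_inv_eq_mul, Real.exp_le_exp]
      have : (π * I * w * ((n ^ 2 : ℤ) : ℂ)).re = -(π * (n:ℝ) ^ 2 * w.im) := by
        push_cast
        rw [show (π * I * w * ((n:ℂ) ^ 2)) = ((π * n ^ 2 : ℝ) : ℂ) * (I * w) by push_cast; ring, re_ofReal_mul]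
        simp
      rw [this]
      gcongr
    rw [norm_mul]
    gcongr
    exact h1.trans h3

lemma h3_diff : DifferentiableOn ℂ h3 UH := by
  have hF : DifferentiableOn ℂ FF UH := by
    rw [show FF = fun τ => cexp (-(π * I * τ / 4)) * B3 τ from funext FF_eq]
    exact DifferentiableOn.mul (by fun_prop) B3_diff
  exact hF.div theta3_diff fun z hz => theta3_ne hz

lemma neg_inv_diff : DifferentiableOn ℂ (fun z : ℂ => -1 / z) UH := by
  intro z hz
  have hz : 0 < z.im := hz
  refine DifferentiableAt.differentiableWithinAt ?_
  have : z ≠ 0 := by rintro rfl; simp at hz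
  fun_prop (disch := assumption)

lemma KK_S1 {t : ℝ} (ht : 0 < t) {a : ℂ} (ha : 0 < a.im) : KK (-1 / (I * t)) (-1 / a) = -(-I * (I * t)) ^ (1 / 2 : ℂ) * KK (I * t) a := by
  have hit : 0 < (I * t : ℂ).im := by rw [Ix_im]; exact ht
  have h := ident_thm (f := fun a => KK (-1 / (I * t)) (-1 / a) - -(-I * (I * t)) ^ (1 / 2 : ℂ) * KK (I * t) a) ?_ ?_ ha
  · exact sub_eq_zero.1 h
  · have e1 := Ei_diff UH_open neg_inv_diff (differentiableOn_const (-1 / (I * t : ℂ))) (fun z hz => im_neg_one_div hz) (fun z hz => im_neg_one_div hit)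
    have e2 := Ei_diff UH_open differentiableOn_id (differentiableOn_const (I * t : ℂ)) (fun z hz => hz) (fun z hz => hit)
    simp only [KK]
    exact ((e1.const_mul _).const_add _).sub (((e2.const_mul _).const_add _).const_mul _)
  · intro y hy
    exact sub_eq_zero.2 (KK_axis ht hy)

lemma KK_S {τ a : ℂ} (hτ : 0 < τ.im) (ha : 0 < a.im) : KK (-1 / τ) (-1 / a) = -(-I * τ) ^ (1 / 2 : ℂ) * KK τ a := by
  have h := ident_thm (f := fun τ => KK (-1 / τ) (-1 / a) - -(-I * τ) ^ (1 / 2 : ℂ) * KK τ a) ?_ ?_ hτ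
  · exact sub_eq_zero.1 h
  · have e1 := Ei_diff UH_open (differentiableOn_const (-1 / a : ℂ)) neg_inv_diff (fun z hz => im_neg_one_div ha) (fun z hz => im_neg_one_div hz)
    have e2 := Ei_diff UH_open (differentiableOn_const a) differentiableOn_id (fun z hz => ha) (fun z hz => hz)
    have e3 : DifferentiableOn ℂ (fun z => h3 (-1 / z)) UH := h3_diff.comp neg_inv_diff fun z hz => im_neg_one_div hz
    have e4 : DifferentiableOn ℂ (fun z : ℂ => (-I * z) ^ (1 / 2 : ℂ)) UH := by
      intro z hz
      have hz : 0 < z.im := hz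
      refine (DifferentiableAt.cpow_const (by fun_prop) (Or.inl ?_)).differentiableWithinAt
      simpa using hz
    simp only [KK]
    exact (e3.add (e1.const_mul _)).sub (e4.neg.mul (h3_diff.add (e2.const_mul _)))
  · intro t ht
    exact sub_eq_zero.2 (KK_S1 ht ha)

lemma Hhat_eq (τ : ℂ) : Hhat τ = 2 * (theta2 τ ^ 4 - theta4 τ ^ 4) / etaDedekind τ ^ 3 - 24 * KK τ (-(starRingEnd ℂ) τ) := by
  have h1 : eichler τ = Ei (-(starRingEnd ℂ) τ) τ := rfl
  have h2 : H0 τ = 2 * (theta2 τ ^ 4 - theta4 τ ^ 4) / etaDedekind τ ^ 3 - 24 / theta3 τ * FF τ := rfl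
  rw [Hhat, h1, h2, KK, h3]; ring

lemma Hhat_I : Hhat I = 0 := by
  have hI : 0 < I.im := by simp
  have e : -1 / I = I := by rw [div_eq_iff I_ne_zero, I_mul_I]
  have e1 : -I * I = 1 := by rw [neg_mul, I_mul_I, neg_neg]
  have h1 := KK_S hI hI
  rw [e, e1, one_cpow] at h1
  have h2 := theta2_S4 hI
  rw [e, I_sq] at h2
  have h4 : KK I I = 0 := by linear_combination h1 / 2
  rw [Hhat_eq, conj_I, neg_neg, h4, h2]; simp

lemma EE_T (τ : ℂ) : EE (τ + 1) = EE τ := by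
  rw [EE, EE, qq, qq, nm_add_one, neg_sq]

lemma eta3_T (τ : ℂ) : etaDedekind (τ + 1) ^ 3 = cexp (π * I / 4) * etaDedekind τ ^ 3 := by
  rw [eta3_eq, eta3_eq, EE_T, ← mul_assoc, ← exp_add]; congr 2; ring

lemma Ei_T (a τ : ℂ) : Ei (a + 1) τ = cexp (π * I / 4) * Ei a (τ + 1) := by
  rw [Ei, Ei, ← integral_const_mul]
  refine setIntegral_congr_fun measurableSet_Ioi fun s hs => ?_
  beta_reduce
  rw [show a + 1 + I * s = (a + I * s) + 1 by ring, eta3_T, show a + I * s + 1 + τ = a + I * s + (τ + 1) by ring]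
  ring

lemma h3_T {τ : ℂ} (h : 0 < τ.im) : cexp (π * I / 4) * h3 (τ + 1) = h3 τ - theta2 τ ^ 4 / (4 * etaDedekind τ ^ 3) := by
  have hD := D_id h
  have hP := theta_prod h
  have n3 := theta3_ne h
  have n4 := theta4_ne h
  have ne := pow_ne_zero 3 (eta_ne h)
  have hc : cexp (π * I * τ / 4) ≠ 0 := exp_ne_zero _
  rw [h3, h3, FF_eq, FF_eq, B3_T, theta3_T]
  have e1 : cexp (-(π * I * (τ + 1) / 4)) = (cexp (π * I * τ / 4))⁻¹ * (cexp (π * I / 4))⁻¹ := by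
    rw [← exp_neg, ← exp_neg, ← exp_add]; congr 1; ring
  rw [e1, exp_neg]
  have hk : cexp (π * I / 4) ≠ 0 := exp_ne_zero _
  generalize cexp (π * I / 4) = k at *
  generalize cexp (π * I * τ / 4) = c at *
  rw [show 4 * etaDedekind τ ^ 3 = 2 * (2 * etaDedekind τ ^ 3) by ring]
  have hne2 : theta2 τ * theta3 τ * theta4 τ ≠ 0 := by rw [hP]; exact mul_ne_zero two_ne_zero ne
  have n2 : theta2 τ ≠ 0 := fun h => hne2 (by rw [h]; ring)
  rw [← hP]
  field_simp
  linear_combination 2 * hD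

lemma Hhat_rho : Hhat (cexp (2 * (π:ℂ) * I / 3)) = 0 := by
  set ρ := cexp (2 * (π:ℂ) * I / 3) with hρ
  have hform : ρ = -1 / 2 + (√3 / 2 : ℝ) * I := by
    rw [hρ, show 2 * (π:ℂ) * I / 3 = ((π - π / 3 : ℝ) : ℂ) * I by push_cast; ring, exp_mul_I, ← ofReal_cos, ← ofReal_sin, Real.cos_pi_sub, Real.sin_pi_sub, Real.cos_pi_div_three, Real.sin_pi_div_three]
    push_cast; ring
  have him : 0 < ρ.im := by rw [hform]; simp
  have hs3 : ((√3 : ℝ) : ℂ) ^ 2 = 3 := by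
    rw [← ofReal_pow, Real.sq_sqrt (by norm_num)]; norm_num
  have hmin : ρ ^ 2 + ρ + 1 = 0 := by
    rw [hform]; push_cast; linear_combination (((√3 : ℝ) : ℂ)) ^ 2 / 4 * I_sq - hs3 / 4
  have hconj : -(starRingEnd ℂ) ρ = ρ + 1 := by
    rw [hform]; simp only [map_add, map_mul, map_div₀, map_neg, map_one, conj_I, conj_ofReal, map_ofNat]; ring
  have hρ0 : ρ ≠ 0 := exp_ne_zero _
  have hσ : 0 < (ρ + 1).im := by simpa using him
  have hσ0 : ρ + 1 ≠ 0 := by intro h; rw [h] at hσ; simp at hσ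
  have e1 : -1 / ρ = ρ + 1 := by rw [div_eq_iff hρ0]; linear_combination -hmin
  have e2 : -1 / (ρ + 1) = ρ := by rw [div_eq_iff hσ0]; linear_combination -hmin
  have e3 : (-I * ρ) ^ (1 / 2 : ℂ) = cexp (π * I / 12) := by
    have h1 : -I * ρ = cexp (π * I / 6) := by
      rw [show (-I : ℂ) = cexp (-(π / 2 * I)) by rw [exp_neg, exp_pi_div_two_mul_I, inv_I], hρ, ← exp_add]
      congr 1; ring
    have hpi := Real.pi_pos
    have him6 : (π * I / 6 : ℂ).im = π / 6 := by
      rw [show (π * I / 6 : ℂ) = ((π / 6 : ℝ) : ℂ) * I by push_cast; ring]; simp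
    rw [h1, cpow_def_of_ne_zero (exp_ne_zero _), log_exp (by rw [him6]; linarith) (by rw [him6]; linarith)]
    congr 1; ring
  have k1 := KK_S him hσ
  rw [e1, e2, e3] at k1
  have k2 : cexp (π * I / 4) * KK (ρ + 1) ρ = KK ρ (ρ + 1) - theta2 ρ ^ 4 / (4 * etaDedekind ρ ^ 3) := by
    rw [KK, KK, Ei_T, mul_add, h3_T him]; ring
  have e4 : cexp (π * I / 4) * cexp (π * I / 12) = ρ + 1 := by
    have h5 : ρ + 1 = -ρ ^ 2 := by linear_combination hmin
    rw [h5, hρ, ← exp_nat_mul, ← exp_add, ← neg_one_mul, ← exp_neg_pi_mul_I, ← exp_add]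
    congr 1; push_cast; ring
  have t1 := theta2_S4 him
  rw [e1, theta2_T4] at t1
  have ne := pow_ne_zero 3 (eta_ne him)
  rw [Hhat_eq, hconj]
  rw [k1] at k2
  have k3 : KK ρ (ρ + 1) * (ρ + 2) = theta2 ρ ^ 4 / (4 * etaDedekind ρ ^ 3) := by
    linear_combination -k2 - KK ρ (ρ + 1) * e4
  have t2 : theta2 ρ ^ 4 = ρ ^ 2 * theta4 ρ ^ 4 := by linear_combination -t1
  have t3 : theta4 ρ ^ 4 = ρ * theta2 ρ ^ 4 := by
    linear_combination -ρ * t2 - (ρ - 1) * theta4 ρ ^ 4 * hmin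
  rw [t3]
  have k4 : 3 * KK ρ (ρ + 1) = (1 - ρ) * (theta2 ρ ^ 4 / (4 * etaDedekind ρ ^ 3)) := by
    rw [← k3]; linear_combination KK ρ (ρ + 1) * hmin
  have k5 : 24 * KK ρ (ρ + 1) = 8 * ((1 - ρ) * (theta2 ρ ^ 4 / (4 * etaDedekind ρ ^ 3))) := by linear_combination 8 * k4
  rw [k5]; field_simp; ring

/-- The completion `Ĥ` vanishes at the elliptic points of `SL(2,ℤ)`:
`Ĥ(i) = 0` and `Ĥ(e^{2πi/3}) = 0`. -/
theorem Hhat_vanishes_at_elliptic_points :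
    Hhat Complex.I = 0 ∧
    Hhat (Complex.exp (2 * (Real.pi : ℂ) * Complex.I / 3)) = 0 := by
  exact ⟨Hhat_I, Hhat_rho⟩
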